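/- arXiv:0804.0704 — 4 statements merged into one kernel-verified Lean document; each statement's English description precedes it below -/
import Mathlib

section
/- Let (W,S) be a Coxeter system with Coxeter matrix (m_{i,j})_{i,j∈I}, and let v, w ∈ W with disjoint supports. Then vw = wv if and only if m_{i,j} = 2 for all i ∈ Supp(v) and j ∈ Supp(w). -/
/-- The support of `w`: the set of indices appearing in every reduced word for `w`
(equivalently, in some reduced word, since all reduced words use the same letters). -/
def CoxeterSystem.support {B W : Type*} [Group W] {M : CoxeterMatrix B}
    (cs : CoxeterSystem M W) (w : W) : Set B :=
  {i | ∀ ω : List B, cs.IsReduced ω → cs.wordProd ω = w → i ∈ ω}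

namespace CoxRep

open Module CoxeterSystem

noncomputable section

variable {B : Type*}

/-- The space of the reflection representation: root part and weight part. -/
abbrev V (B : Type*) := (B →₀ ℝ) × (B → ℝ)

def A (M : CoxeterMatrix B) (i j : B) : ℝ := -(2 * Real.cos (Real.pi / (M i j : ℝ)))

lemma A_self (M : CoxeterMatrix B) (i : B) : A M i i = 2 := by
  simp [A]

lemma A_symm (M : CoxeterMatrix B) (i j : B) : A M i j = A M j i := by
  simp [A, M.symmetric i j]

lemma A_nonpos (M : CoxeterMatrix B) {i j : B} (h : i ≠ j) : A M i j ≤ 0 := by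
  have h1 := M.off_diagonal i j h
  unfold A
  have : 0 ≤ Real.cos (Real.pi / (M i j : ℝ)) := by
    rcases Nat.eq_zero_or_pos (M i j) with h0 | h0
    · simp [h0]
    · have h2 : (2 : ℝ) ≤ M i j := by exact_mod_cast (by omega : 2 ≤ M i j)
      have hp := Real.pi_pos
      apply Real.cos_nonneg_of_neg_pi_div_two_le_of_le
      · have : 0 ≤ Real.pi / (M i j : ℝ) := by positivity
        linarith
      · gcongr
  linarith

lemma eq_two_of_A_eq_zero (M : CoxeterMatrix B) {i j : B} (h : i ≠ j) (hA : A M i j = 0) :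
    M i j = 2 := by
  have h1 := M.off_diagonal i j h
  by_contra h2
  have : 0 < Real.cos (Real.pi / (M i j : ℝ)) := by
    rcases Nat.eq_zero_or_pos (M i j) with h0 | h0
    · simp [h0]
    · have h2 : (2 : ℝ) < M i j := by exact_mod_cast (by omega : 2 < M i j)
      have hp := Real.pi_pos
      apply Real.cos_pos_of_mem_Ioo
      constructor
      · have : 0 ≤ Real.pi / (M i j : ℝ) := by positivity
        linarith
      · gcongr
  unfold A at hA
  linarith

def root (i : B) : V B := (Finsupp.single i 1, 0)

open Classical in
def weight (i : B) : V B := (0, Pi.single i 1)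

def phi (M : CoxeterMatrix B) (i : B) : Dual ℝ (V B) :=
  (Finsupp.linearCombination ℝ (A M i)).comp (LinearMap.fst ℝ _ _) +
    (LinearMap.proj (R := ℝ) (φ := fun _ : B => ℝ) i).comp (LinearMap.snd ℝ _ _)

lemma phi_apply (M : CoxeterMatrix B) (i : B) (x : V B) :
    phi M i x = (x.1.sum fun k c => c * A M i k) + x.2 i := by
  simp [phi, Finsupp.linearCombination_apply]

@[simp] lemma phi_root (M : CoxeterMatrix B) (i j : B) : phi M i (root j) = A M i j := by
  simp [phi, root]

lemma phi_weight_self (M : CoxeterMatrix B) (i : B) : phi M i (weight i) = 1 := by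
  simp [phi, weight]

lemma phi_weight_ne (M : CoxeterMatrix B) {i j : B} (h : i ≠ j) : phi M i (weight j) = 0 := by
  simp [phi, weight, h]

lemma phi_root_self (M : CoxeterMatrix B) (i : B) : phi M i (root i) = 2 := by
  simp [A_self]

def refl (M : CoxeterMatrix B) (i : B) : V B ≃ₗ[ℝ] V B := reflection (phi_root_self M i)

lemma refl_apply (M : CoxeterMatrix B) (i : B) (x : V B) :
    refl M i x = x - phi M i x • root i := reflection_apply _ _

lemma liftable (M : CoxeterMatrix B) : M.IsLiftable (refl M) := by
  intro i j
  by_cases hij : i = j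
  · subst hij
    rw [M.diagonal, pow_one]
    ext1 x
    exact involutive_reflection (phi_root_self M i) x
  have h1 := M.off_diagonal i j hij
  rcases Nat.eq_zero_or_pos (M i j) with h0 | h0
  · simp [h0]
  by_cases h2 : M i j = 2
  · have hA : A M i j = 0 := by simp [A, h2]
    have hA' : A M j i = 0 := by rw [A_symm, hA]
    rw [h2, pow_two]
    ext1 x
    simp only [LinearEquiv.mul_apply, refl_apply, map_sub, map_smul, phi_root, hA, hA', A_self,
      LinearEquiv.coe_one, id]
    module
  ext1 z
  set m := M i j with hm
  set θ : ℝ := Real.pi / m with hθ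
  have hmθ : (m : ℝ) * θ = Real.pi := by
    rw [hθ]; field_simp
  have ht : 2 * Real.cos (2 * θ) = phi M i (root j) * phi M j (root i) - 2 := by
    rw [phi_root, phi_root, A_symm M j i, A, Real.cos_two_mul]
    ring
  have hs : Real.sin (2 * θ) ≠ 0 := by
    have hm3 : (2 : ℝ) < m := by exact_mod_cast (by omega : 2 < m)
    have hp := Real.pi_pos
    apply ne_of_gt
    apply Real.sin_pos_of_pos_of_lt_pi
    · positivity
    · rw [← hmθ]
      have : 0 < θ := by positivity
      gcongr
  have key := reflection_mul_reflection_pow_apply (phi_root_self M i) (phi_root_self M j) m z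
    (2 * Real.cos (2 * θ)) ht
  change ((refl M i * refl M j) ^ m) z = _ at key
  rw [key]
  have hS := fun n : ℤ => Polynomial.Chebyshev.S_two_mul_real_cos (2 * θ) n
  obtain ⟨k, hk | hk⟩ := Nat.even_or_odd' m
  · have e1 : ((m : ℤ) - 2) / 2 = k - 1 := by omega
    have e2 : ((m : ℤ) - 1) / 2 = k - 1 := by omega
    have z1 : (Polynomial.Chebyshev.S ℝ ((k : ℤ) - 1)).eval (2 * Real.cos (2 * θ)) = 0 := by
      have := hS (k - 1)
      have e : ((((k : ℤ) - 1 : ℤ) : ℝ) + 1) * (2 * θ) = Real.pi := by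
        rw [← hmθ, hk]; push_cast; ring
      rw [e, Real.sin_pi] at this
      exact (mul_eq_zero.mp this).resolve_right hs
    rw [e1, e2, z1]
    simp
  · have e1 : ((m : ℤ) - 2) / 2 = k - 1 := by omega
    have e2 : ((m : ℤ) - 1) / 2 = k := by omega
    have e3 : ((m : ℤ) - 3) / 2 = k - 1 := by omega
    have e4 : (m : ℤ) / 2 = k := by omega
    have z1 : (Polynomial.Chebyshev.S ℝ (k : ℤ)).eval (2 * Real.cos (2 * θ)) +
        (Polynomial.Chebyshev.S ℝ ((k : ℤ) - 1)).eval (2 * Real.cos (2 * θ)) = 0 := by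
      have h1 := hS (k - 1)
      have h2 := hS k
      have e : ((((k : ℤ) - 1 : ℤ) : ℝ) + 1) * (2 * θ) = Real.pi - θ := by
        rw [← hmθ, hk]; push_cast; ring
      have e' : (((k : ℤ) : ℝ) + 1) * (2 * θ) = θ + Real.pi := by
        rw [← hmθ, hk]; push_cast; ring
      rw [e, Real.sin_pi_sub] at h1
      rw [e', Real.sin_add_pi] at h2
      have : ((Polynomial.Chebyshev.S ℝ (k : ℤ)).eval (2 * Real.cos (2 * θ)) +
        (Polynomial.Chebyshev.S ℝ ((k : ℤ) - 1)).eval (2 * Real.cos (2 * θ))) *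
          Real.sin (2 * θ) = 0 := by
        linear_combination h1 + h2
      exact (mul_eq_zero.mp this).resolve_right hs
    rw [e1, e2, e3, e4, z1]
    simp

variable {W : Type*} [Group W] {M : CoxeterMatrix B} (cs : CoxeterSystem M W)

def rep : W →* (V B ≃ₗ[ℝ] V B) := cs.lift ⟨refl M, liftable M⟩

lemma rep_simple (i : B) (x : V B) : rep cs (cs.simple i) x = x - phi M i x • root i := by
  rw [rep, cs.lift_apply_simple, refl_apply]

lemma rep_mul (v w : W) (x : V B) : rep cs (v * w) x = rep cs v (rep cs w x) := by
  rw [map_mul, LinearEquiv.mul_apply]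

lemma rep_one (x : V B) : rep cs 1 x = x := by simp

lemma rep_snd (w : W) (x : V B) : (rep cs w x).2 = x.2 := by
  induction w using cs.simple_induction_left generalizing x with
  | one => simp
  | mul_simple_left w i ih => rw [rep_mul, rep_simple]; simp [root, ih]

lemma rep_fst_of_notMem (ω : List B) {k : B} (hk : k ∉ ω) (x : V B) :
    (rep cs (cs.wordProd ω) x).1 k = x.1 k := by
  induction ω with
  | nil => simp
  | cons i ω ih =>
    simp only [List.mem_cons, not_or] at hk
    rw [wordProd_cons, rep_mul, rep_simple]
    simp [root, ih hk.2, Ne.symm hk.1]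

lemma rep_weight_of_notMem (ω : List B) {k : B} (hk : k ∉ ω) :
    rep cs (cs.wordProd ω) (weight k) = weight k := by
  induction ω with
  | nil => simp
  | cons i ω ih =>
    simp only [List.mem_cons, not_or] at hk
    rw [wordProd_cons, rep_mul, ih hk.2, rep_simple, phi_weight_ne M (Ne.symm hk.1)]
    simp

/-- Chebyshev-like coefficients. -/
def cf (c : ℝ) : ℕ → ℝ
  | 0 => 0
  | 1 => 1
  | n + 2 => c * cf c (n + 1) - cf c n

lemma cf_sin (θ : ℝ) (n : ℕ) : cf (2 * Real.cos θ) n * Real.sin θ = Real.sin (n * θ) ∧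
    cf (2 * Real.cos θ) (n + 1) * Real.sin θ = Real.sin ((n + 1) * θ) := by
  induction n with
  | zero => simp [cf]
  | succ n ih =>
    refine ⟨by push_cast; exact ih.2, ?_⟩
    rw [cf, sub_mul, ih.1, mul_assoc, ih.2]
    push_cast
    have e1 : ((n : ℝ) + 1 + 1) * θ = (n + 1) * θ + θ := by ring
    have e2 : (n : ℝ) * θ = (n + 1) * θ - θ := by ring
    rw [e1, e2, Real.sin_add, Real.sin_sub]
    ring

lemma cf_two (n : ℕ) : cf 2 n = n ∧ cf 2 (n + 1) = n + 1 := by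
  induction n with
  | zero => simp [cf]
  | succ n ih =>
    refine ⟨by push_cast; exact ih.2, ?_⟩
    rw [cf, ih.1, ih.2]
    push_cast
    ring

lemma cf_nonneg {i j : B} (hij : i ≠ j) (n : ℕ) (hn : M i j = 0 ∨ n ≤ M i j) :
    0 ≤ cf (-A M i j) n := by
  have h1 := M.off_diagonal i j hij
  rcases Nat.eq_zero_or_pos (M i j) with h0 | h0
  · have : -A M i j = 2 := by simp [A, h0]
    rw [this, (cf_two n).1]
    positivity
  · have hn' : n ≤ M i j := by omega
    have h2 : (2 : ℝ) ≤ M i j := by exact_mod_cast (by omega : 2 ≤ M i j)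
    have hp := Real.pi_pos
    have : -A M i j = 2 * Real.cos (Real.pi / (M i j : ℝ)) := by simp [A]
    rw [this]
    have key := (cf_sin (Real.pi / (M i j : ℝ)) n).1
    have hs : 0 < Real.sin (Real.pi / (M i j : ℝ)) := by
      apply Real.sin_pos_of_pos_of_lt_pi
      · positivity
      · apply div_lt_self hp; linarith
    have hs' : 0 ≤ Real.sin (n * (Real.pi / (M i j : ℝ))) := by
      apply Real.sin_nonneg_of_nonneg_of_le_pi
      · positivity
      · have : (n : ℝ) ≤ M i j := by exact_mod_cast hn'
        calc (n : ℝ) * (Real.pi / (M i j : ℝ)) ≤ (M i j : ℝ) * (Real.pi / (M i j : ℝ)) := by gcongr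
          _ = Real.pi := by field_simp
    rw [← key] at hs'
    exact nonneg_of_mul_nonneg_left hs' hs

lemma rep_alternating (i j : B) (n : ℕ) :
    rep cs (cs.wordProd (alternatingWord i j n)) (root i) =
      if Even n then cf (-A M i j) (n + 1) • root i + cf (-A M i j) n • root j
      else cf (-A M i j) n • root i + cf (-A M i j) (n + 1) • root j := by
  induction n with
  | zero => simp [alternatingWord, cf]
  | succ n ih =>
    rw [alternatingWord_succ', wordProd_cons, rep_mul, ih, rep_simple]
    by_cases hn : Even n
    · have hn' : ¬ Even (n + 1) := by simpa [Nat.even_add_one] using hn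
      simp only [hn, hn', if_true, if_false, map_add, map_smul, phi_root, A_self, smul_eq_mul, cf,
        A_symm M j i]
      module
    · have hn' : Even (n + 1) := by simpa [Nat.even_add_one] using hn
      simp only [hn, hn', if_true, if_false, map_add, map_smul, phi_root, A_self, smul_eq_mul, cf]
      module

def Pos (x : V B) : Prop := ∀ k, 0 ≤ x.1 k

lemma Pos.comb {x y : V B} (hx : Pos x) (hy : Pos y) {a b : ℝ} (ha : 0 ≤ a) (hb : 0 ≤ b) :
    Pos (a • x + b • y) := by
  intro k
  have := mul_nonneg ha (hx k)
  have := mul_nonneg hb (hy k)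
  simp only [Prod.fst_add, Prod.smul_fst, Finsupp.add_apply, Finsupp.smul_apply, smul_eq_mul]
  linarith

lemma pos_root (i : B) : Pos (root i) := by
  intro k
  classical
  simp only [root, Finsupp.single_apply]
  split_ifs <;> norm_num

lemma rep_pos (n : ℕ) : ∀ (w : W) (i : B), cs.length w = n →
    cs.length (w * cs.simple i) = cs.length w + 1 → Pos (rep cs w (root i)) := by
  induction n using Nat.strong_induction_on with
  | _ n IH =>
  intro w i hw hi
  by_cases h1 : w = 1
  · subst h1; rw [rep_one]; exact pos_root i
  obtain ⟨j, hj⟩ := cs.exists_rightDescent_of_ne_one h1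
  rw [isRightDescent_iff] at hj
  have hij : i ≠ j := by rintro rfl; omega
  let P : ℕ → Prop := fun k =>
    ∃ u : W, w = u * cs.wordProd (alternatingWord i j k) ∧ cs.length w = cs.length u + k
  have hP1 : P 1 := ⟨w * cs.simple j, by simp [alternatingWord], by omega⟩
  have hPb : ∀ k, P k → k ≤ n := by rintro k ⟨u, -, h⟩; omega
  classical
  set k := Nat.findGreatest P n with hk
  have hPk : P k := Nat.findGreatest_spec (hPb 1 hP1) hP1
  have hk1 : 1 ≤ k := Nat.le_findGreatest (hPb 1 hP1) hP1
  have hPk' : ¬ P (k + 1) := by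
    intro h
    have := Nat.le_findGreatest (hPb _ h) h
    omega
  clear_value k
  obtain ⟨u, hu, hlu⟩ := hPk
  -- next letter
  have hx : cs.length (u * cs.simple (if Even k then j else i)) = cs.length u + 1 := by
    rcases cs.length_mul_simple u (if Even k then j else i) with h | h
    · exact h
    · exfalso
      apply hPk'
      refine ⟨u * cs.simple (if Even k then j else i), ?_, by omega⟩
      rw [alternatingWord_succ', wordProd_cons, mul_assoc, simple_mul_simple_cancel_left]
      exact hu
  have hy : cs.length (u * cs.simple (if Even k then i else j)) = cs.length u + 1 := by
    rcases cs.length_mul_simple u (if Even k then i else j) with h | h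
    · exact h
    · exfalso
      obtain ⟨l, rfl⟩ : ∃ l, k = l + 1 := ⟨k - 1, by omega⟩
      have e : (if Even l then j else i) = (if Even (l + 1) then i else j) := by
        by_cases hl : Even l <;> simp [hl, Nat.even_add_one]
      rw [alternatingWord_succ', wordProd_cons, e, ← mul_assoc] at hu
      have h3 := cs.length_mul_le (u * cs.simple (if Even (l + 1) then i else j))
        (cs.wordProd (alternatingWord i j l))
      have h4 := cs.length_wordProd_le (alternatingWord i j l)
      rw [← hu] at h3
      rw [length_alternatingWord] at h4
      omega
  have hpi : Pos (rep cs u (root i)) := by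
    refine IH (cs.length u) (by omega) u i rfl ?_
    by_cases he : Even k
    · simpa [he] using hy
    · simpa [he] using hx
  have hpj : Pos (rep cs u (root j)) := by
    refine IH (cs.length u) (by omega) u j rfl ?_
    by_cases he : Even k
    · simpa [he] using hx
    · simpa [he] using hy
  have hm : M i j = 0 ∨ k + 1 ≤ M i j := by
    by_contra hcon
    push Not at hcon
    have hsym := M.symmetric i j
    apply cs.not_isReduced_alternatingWord j i (m := k + 1) (hsym ▸ hcon.1)
      (hsym ▸ hcon.2)
    have h3 := cs.length_mul_le u (cs.wordProd (alternatingWord j i (k + 1)))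
    have h4 := cs.length_wordProd_le (alternatingWord j i (k + 1))
    have e : u * cs.wordProd (alternatingWord j i (k + 1)) = w * cs.simple i := by
      rw [alternatingWord_succ, wordProd_concat, ← mul_assoc, ← hu]
    rw [e] at h3
    rw [length_alternatingWord] at h4
    rw [CoxeterSystem.IsReduced, length_alternatingWord]
    omega
  have c1 := cf_nonneg hij (k + 1) hm
  have c0 := cf_nonneg (M := M) hij k (by omega)
  rw [hu, rep_mul, rep_alternating]
  split_ifs
  · rw [map_add, map_smul, map_smul]
    exact hpi.comb hpj c1 c0
  · rw [map_add, map_smul, map_smul]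
    exact hpi.comb hpj c0 c1

lemma reduced_concat {ω : List B} {i : B} (h : cs.IsReduced (ω ++ [i])) :
    cs.IsReduced ω ∧ Pos (rep cs (cs.wordProd ω) (root i)) := by
  have h1 : cs.IsReduced ω := by simpa using h.take ω.length
  refine ⟨h1, rep_pos cs _ _ i rfl ?_⟩
  rw [CoxeterSystem.IsReduced] at h h1
  rw [wordProd_append, wordProd_singleton, List.length_append] at h
  rw [h, h1]; rfl

lemma rep_root_fst_ne (w : W) (i : B) : (rep cs w (root i)).1 ≠ 0 := by
  intro h
  have h0 : rep cs w (root i) = 0 := Prod.ext h (by rw [rep_snd]; rfl)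
  have : root i = (0 : V B) := by simpa using h0
  have h2 := congrArg (fun x : V B => x.1 i) this
  simp [root] at h2

lemma telescope (ω : List B) (h : cs.IsReduced ω) (x : V B) (hx : ∀ i ∈ ω, phi M i x ≤ 0) :
    (∀ k, x.1 k ≤ (rep cs (cs.wordProd ω) x).1 k) ∧
    ((∀ k, (rep cs (cs.wordProd ω) x).1 k ≤ x.1 k) → ∀ i ∈ ω, phi M i x = 0) := by
  induction ω using List.reverseRecOn with
  | nil => simp
  | append_singleton ω i ih =>
    obtain ⟨hr, hp⟩ := reduced_concat cs h
    obtain ⟨ih1, ih2⟩ := ih hr (fun k hk => hx k (by simp [hk]))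
    have hxi := hx i (by simp)
    have e : ∀ k, (rep cs (cs.wordProd (ω ++ [i])) x).1 k = (rep cs (cs.wordProd ω) x).1 k
        + (-phi M i x) * (rep cs (cs.wordProd ω) (root i)).1 k := by
      intro k
      rw [wordProd_append, wordProd_singleton, rep_mul, rep_simple, map_sub, map_smul]
      simp [sub_eq_add_neg]
    have hnn : ∀ k, 0 ≤ (-phi M i x) * (rep cs (cs.wordProd ω) (root i)).1 k :=
      fun k => mul_nonneg (by linarith) (hp k)
    refine ⟨fun k => ?_, fun hle => ?_⟩
    · rw [e]; linarith [ih1 k, hnn k]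
    · have hle' : ∀ k, (rep cs (cs.wordProd ω) x).1 k ≤ x.1 k := by
        intro k
        have := hle k
        rw [e] at this
        linarith [hnn k]
      intro k hk
      rw [List.mem_append, List.mem_singleton] at hk
      rcases hk with hk | rfl
      · exact ih2 hle' k hk
      · by_contra hne
        apply rep_root_fst_ne cs (cs.wordProd ω) k
        ext l
        have h1 := hle l
        rw [e] at h1
        have h2 : (-phi M k x) * (rep cs (cs.wordProd ω) (root k)).1 l = 0 := by
          linarith [hnn l, ih1 l]
        have := (mul_eq_zero.mp h2).resolve_left (by simpa using hne)
        simpa using this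

lemma rep_weight_ne {ω : List B} (h : cs.IsReduced ω) {i : B} (hi : i ∈ ω) :
    rep cs (cs.wordProd ω) (weight i) ≠ weight i := by
  intro heq
  have hT := (telescope cs ω h (-weight i) (by
    intro k _
    rw [map_neg]
    by_cases hk : k = i
    · subst hk; rw [phi_weight_self]; norm_num
    · rw [phi_weight_ne M hk]; simp)).2 (by
      intro k; rw [map_neg, heq]) i hi
  rw [map_neg, phi_weight_self] at hT
  norm_num at hT

lemma mem_support_iff {ω : List B} (h : cs.IsReduced ω) (i : B) :
    i ∈ cs.support (cs.wordProd ω) ↔ i ∈ ω := by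
  refine ⟨fun hi => hi ω h rfl, fun hi ω' _ he => ?_⟩
  by_contra hn
  have := rep_weight_of_notMem cs ω' hn
  rw [he] at this
  exact rep_weight_ne cs h hi this

lemma commute_simple {i j : B} (h : M i j = 2) : Commute (cs.simple i) (cs.simple j) := by
  have h1 := cs.simple_mul_simple_pow i j
  rw [h, pow_two] at h1
  have := eq_inv_of_mul_eq_one_left h1
  rw [mul_inv_rev, inv_simple, inv_simple] at this
  exact this

lemma commute_word (x : W) (ω : List B) (h : ∀ i ∈ ω, Commute x (cs.simple i)) :
    Commute x (cs.wordProd ω) := by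
  induction ω with
  | nil => simp
  | cons i ω ih =>
    rw [wordProd_cons]
    exact (h i (by simp)).mul_right (ih fun k hk => h k (by simp [hk]))

lemma forward (a : List B) (ha : cs.IsReduced a) (b : List B) (hb : cs.IsReduced b)
    (hab : ∀ i ∈ a, i ∉ b) (hc : Commute (cs.wordProd a) (cs.wordProd b)) :
    ∀ i ∈ a, ∀ j ∈ b, M i j = 2 := by
  induction b using List.reverseRecOn with
  | nil => simp
  | append_singleton b j ih =>
    obtain ⟨hr, hp⟩ := reduced_concat cs hb
    have haj : ∀ i ∈ a, i ≠ j := fun i hi he => hab i hi (by simp [he])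
    have hy : rep cs (cs.wordProd (b ++ [j])) (root j) = -rep cs (cs.wordProd b) (root j) := by
      rw [wordProd_append, wordProd_singleton, rep_mul, rep_simple, phi_root_self, ← map_neg]
      congr 1
      module
    set y := rep cs (cs.wordProd b) (root j) with hydef
    have hy0 : ∀ i ∈ a, y.1 i = 0 := by
      intro i hi
      have := rep_fst_of_notMem cs (b ++ [j]) (hab i hi) (root j)
      rw [hy] at this
      simpa [root, Finsupp.single_apply, (haj i hi).symm] using this
    have hy2 : y.2 = 0 := by rw [hydef, rep_snd]; rfl
    have hphi : ∀ i ∈ a, phi M i y ≤ 0 := by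
      intro i hi
      rw [phi_apply, hy2]
      simp only [Pi.zero_apply, add_zero]
      apply Finset.sum_nonpos
      intro k hk
      have hik : i ≠ k := by
        rintro rfl
        exact (Finsupp.mem_support_iff.mp hk) (hy0 _ hi)
      exact mul_nonpos_of_nonneg_of_nonpos (hp k) (A_nonpos M hik)
    have T1 := (telescope cs a ha y hphi).1
    have T2 := (telescope cs a ha (root j) (fun i hi => by
      rw [phi_root]; exact A_nonpos M (haj i hi))).2 (by
        intro k
        by_cases hk : k ∈ a
        · have e1 := rep_fst_of_notMem cs (b ++ [j]) (hab k hk)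
            (rep cs (cs.wordProd a) (root j))
          rw [← rep_mul, ← hc.eq, rep_mul, hy, map_neg] at e1
          have e2 := T1 k
          rw [hy0 k hk] at e2
          have e3 := pos_root j k
          rw [← e1]
          simp only [Prod.fst_neg, Finsupp.neg_apply]
          linarith
        · exact (rep_fst_of_notMem cs a hk _).le)
    have hj2 : ∀ i ∈ a, M i j = 2 := by
      intro i hi
      have := T2 i hi
      rw [phi_root] at this
      exact eq_two_of_A_eq_zero M (haj i hi) this
    have hcj : Commute (cs.wordProd a) (cs.simple j) :=
      (commute_word cs _ a fun i hi => (commute_simple cs (hj2 i hi)).symm).symm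
    have hcb : Commute (cs.wordProd a) (cs.wordProd b) := by
      have := hc.mul_right hcj
      rwa [wordProd_append, wordProd_singleton, simple_mul_simple_cancel_right] at this
    have ih' := ih hr (fun i hi hb' => hab i hi (by simp [hb'])) hcb
    intro i hi k hk
    rw [List.mem_append, List.mem_singleton] at hk
    rcases hk with hk | rfl
    · exact ih' i hi k hk
    · exact hj2 i hi

end

end CoxRep

/-- If `v` and `w` have disjoint supports, then `vw = wv` iff `m i j = 2` for all
`i ∈ Supp v` and `j ∈ Supp w`. -/
theorem commute_iff_of_disjoint_support {B W : Type*} [Group W] {M : CoxeterMatrix B}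
    (cs : CoxeterSystem M W) (v w : W)
    (h : Disjoint (cs.support v) (cs.support w)) :
    v * w = w * v ↔ ∀ i ∈ cs.support v, ∀ j ∈ cs.support w, M.M i j = 2 := by
  obtain ⟨a, ha, rfl⟩ := cs.exists_isReduced v
  obtain ⟨b, hb, rfl⟩ := cs.exists_isReduced w
  simp only [CoxRep.mem_support_iff cs ha, CoxRep.mem_support_iff cs hb]
  constructor
  · intro hc
    refine CoxRep.forward cs a ha b hb ?_ hc
    intro i hi hi'
    exact Set.disjoint_left.mp h ((CoxRep.mem_support_iff cs ha i).mpr hi)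
      ((CoxRep.mem_support_iff cs hb i).mpr hi')
  · intro hm
    apply CoxRep.commute_word
    intro j hj
    apply Commute.symm
    apply CoxRep.commute_word
    intro i hi
    exact (CoxRep.commute_simple cs (hm i hi j hj)).symm
end

section
/- Let (W,S) be a Coxeter system indexed by I and let {α, β} be a spherical 2-partition of I. Then |r_α r_β| = 2 if and only if m_{i,j} = 2 for all i ∈ α and j ∈ β (i.e. Γ = Γ_α × Γ_β). -/
/-- `α` is spherical: the standard parabolic subgroup it generates is finite. -/
def IsSpherical {B W : Type*} [Group W] {M : CoxeterMatrix B} (cs : CoxeterSystem M W)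
    (α : Set B) : Prop :=
  Set.Finite ((Subgroup.closure (cs.simple '' α) : Subgroup W) : Set W)

/-- `x` is the longest element of the standard parabolic subgroup generated by `α`. -/
def IsLongestOf {B W : Type*} [Group W] {M : CoxeterMatrix B} (cs : CoxeterSystem M W)
    (α : Set B) (x : W) : Prop :=
  x ∈ Subgroup.closure (cs.simple '' α) ∧
  (∀ u ∈ Subgroup.closure (cs.simple '' α), cs.length u ≤ cs.length x) ∧
  (∀ u ∈ Subgroup.closure (cs.simple '' α), cs.length u = cs.length x → u = x)

namespace CoxGeo

open Module CoxeterSystem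

/-- Chebyshev-like sequence. -/
noncomputable def cheb (q : ℝ) : ℕ → ℝ
  | 0 => 0
  | 1 => 1
  | n + 2 => q * cheb q (n + 1) - cheb q n

lemma cheb_two (n : ℕ) : cheb 2 n = n := by
  induction n using Nat.twoStepInduction with
  | zero => simp [cheb]
  | one => simp [cheb]
  | more n h1 h2 => rw [cheb, h1, h2]; push_cast; ring

lemma cheb_cos (θ : ℝ) (n : ℕ) : cheb (2 * Real.cos θ) n * Real.sin θ = Real.sin (n * θ) := by
  induction n using Nat.twoStepInduction with
  | zero => simp [cheb]
  | one => simp [cheb]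
  | more n h1 h2 =>
    rw [cheb, sub_mul, mul_assoc, h1, h2]
    have e1 : ((n + 2 : ℕ) : ℝ) * θ = ((n + 1 : ℕ) : ℝ) * θ + θ := by push_cast; ring
    have e2 : (n : ℝ) * θ = ((n + 1 : ℕ) : ℝ) * θ - θ := by push_cast; ring
    rw [e1, e2, Real.sin_add, Real.sin_sub]; ring

variable {B : Type*} (M : CoxeterMatrix B)

/-- Gram matrix of the canonical form. -/
noncomputable def gc (i j : B) : ℝ := if M i j = 0 then -1 else -Real.cos (Real.pi / M i j)

lemma gc_symm (i j : B) : gc M i j = gc M j i := by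
  unfold gc; rw [M.symmetric i j]

lemma gc_self (i : B) : gc M i i = 1 := by simp [gc]

lemma two_le {i j : B} (h : i ≠ j) (h0 : M i j ≠ 0) : 2 ≤ M i j := by
  have := M.off_diagonal i j h
  change M i j ≠ 1 at this
  omega

lemma gc_nonpos {i j : B} (h : i ≠ j) : gc M i j ≤ 0 := by
  unfold gc
  split_ifs with h0
  · norm_num
  · have h2 : (2 : ℝ) ≤ M i j := by exact_mod_cast two_le M h h0
    have : Real.pi / M i j ≤ Real.pi / 2 := by
      apply div_le_div_of_nonneg_left Real.pi_pos.le (by norm_num) h2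
    have h3 : 0 ≤ Real.pi / M i j := by positivity
    have := Real.cos_nonneg_of_neg_pi_div_two_le_of_le (by linarith [Real.pi_pos]) this
    linarith

lemma eq_two_of_gc {i j : B} (h : i ≠ j) (h0 : gc M i j = 0) : M i j = 2 := by
  unfold gc at h0
  split_ifs at h0 with h1
  · norm_num at h0
  · by_contra hne
    have h2 := two_le M h h1
    have h3 : (2 : ℝ) < M i j := by exact_mod_cast lt_of_le_of_ne h2 (Ne.symm hne)
    have h4 : Real.pi / M i j < Real.pi / 2 :=
      div_lt_div_of_pos_left Real.pi_pos (by norm_num) h3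
    have h5 : 0 ≤ Real.pi / M i j := by positivity
    have := Real.cos_pos_of_mem_Ioo ⟨by linarith [Real.pi_pos], h4⟩
    linarith

lemma cheb_nonneg {i j : B} (h : i ≠ j) (n : ℕ) (hn : M i j = 0 ∨ n ≤ M i j) :
    0 ≤ cheb (-2 * gc M i j) n := by
  unfold gc
  split_ifs with h0
  · rw [show (-2 * -1 : ℝ) = 2 by norm_num, cheb_two]; positivity
  · have h2 := two_le M h h0
    have hn := hn.resolve_left h0
    have h2' : (2 : ℝ) ≤ M i j := by exact_mod_cast h2
    have hm : (0 : ℝ) < M i j := by linarith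
    rw [show -2 * -Real.cos (Real.pi / M i j) = 2 * Real.cos (Real.pi / M i j) by ring]
    have hs : 0 < Real.sin (Real.pi / M i j) := by
      apply Real.sin_pos_of_pos_of_lt_pi (by positivity)
      rw [div_lt_iff₀ hm]; nlinarith [Real.pi_pos]
    have := cheb_cos (Real.pi / M i j) n
    have h6 : 0 ≤ Real.sin (n * (Real.pi / M i j)) := by
      apply Real.sin_nonneg_of_nonneg_of_le_pi (by positivity)
      rw [← mul_div_assoc, div_le_iff₀ hm]
      have : (n : ℝ) ≤ M i j := by exact_mod_cast hn
      nlinarith [Real.pi_pos]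
    rw [← this] at h6
    exact nonneg_of_mul_nonneg_left h6 hs

/-- canonical bilinear form. -/
noncomputable def bil : (B →₀ ℝ) →ₗ[ℝ] (B →₀ ℝ) →ₗ[ℝ] ℝ :=
  Finsupp.linearCombination ℝ (fun i => Finsupp.linearCombination ℝ (fun j => gc M i j))

/-- basis vector -/
noncomputable abbrev e (i : B) : B →₀ ℝ := Finsupp.single i 1

lemma bil_e (i j : B) : bil M (e i) (e j) = gc M i j := by
  simp [bil, e]

lemma bil_symm (u v : B →₀ ℝ) : bil M u v = bil M v u := by
  have : bil M = (bil M).flip := by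
    ext i j
    simp [bil, gc_symm M i j]
  conv_lhs => rw [this]
  rfl

lemma coroot (i : B) : ((2 : ℝ) • bil M (e i)) (e i) = 2 := by
  simp [-Finsupp.smul_single, bil_e, gc_self]

/-- simple reflection -/
noncomputable def sig (i : B) : (B →₀ ℝ) ≃ₗ[ℝ] (B →₀ ℝ) := Module.reflection (coroot M i)

lemma sig_apply (i : B) (v : B →₀ ℝ) : sig M i v = v - (2 * bil M (e i) v) • e i := by
  rw [sig, Module.reflection_apply]; rfl

lemma sig_sig (i : B) : sig M i * sig M i = 1 := by
  ext1 v
  exact Module.involutive_reflection (coroot M i) v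

lemma bil_sig (i : B) (u v : B →₀ ℝ) : bil M (sig M i u) (sig M i v) = bil M u v := by
  simp only [sig_apply, map_sub, map_smul, LinearMap.sub_apply, LinearMap.smul_apply, smul_eq_mul,
    bil_e, gc_self]
  rw [bil_symm M u (e i)]; ring

open Polynomial.Chebyshev in
lemma S_cos (θ : ℝ) (n : ℤ) :
    (S ℝ n).eval (2 * Real.cos θ) * Real.sin θ = Real.sin ((n + 1) * θ) := by
  rw [← U_real_cos, ← S_comp_two_mul_X]; simp

open Polynomial.Chebyshev in
lemma liftable : M.IsLiftable (sig M) := by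
  intro i j
  by_cases h0 : M i j = 0
  · rw [h0, pow_zero]
  by_cases hij : i = j
  · subst hij; rw [M.diagonal, pow_one, sig_sig]
  have h2 := two_le M hij h0
  rw [sig, sig]
  ext1 z
  have ha : ((2 : ℝ) • bil M (e i)) (e j) = 2 * gc M i j := by
    rw [LinearMap.smul_apply, bil_e]; rfl
  have hb : ((2 : ℝ) • bil M (e j)) (e i) = 2 * gc M i j := by
    rw [LinearMap.smul_apply, bil_e, gc_symm]; rfl
  rw [Module.reflection_mul_reflection_pow_apply, ha, hb]
  set f := ((2 : ℝ) • bil M (e i)) z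
  set g := ((2 : ℝ) • bil M (e j)) z
  have hg : gc M i j = -Real.cos (Real.pi / M i j) := by rw [gc, if_neg h0]
  change _ = z
  rcases h2.eq_or_lt with h2 | h2
  · have : gc M i j = 0 := by rw [hg, ← h2]; simp
    rw [← h2, this]
    simp
    module
  · have h3 : (3 : ℝ) ≤ M i j := by exact_mod_cast h2
    set θ := Real.pi / M i j with hθ
    have hmθ : (M i j : ℝ) * θ = Real.pi := by rw [hθ]; field_simp
    have ht : 2 * gc M i j * (2 * gc M i j) - 2 = 2 * Real.cos (2 * θ) := by
      rw [hg, Real.cos_two_mul]; ring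
    have hs : Real.sin (2 * θ) ≠ 0 := by
      apply ne_of_gt
      apply Real.sin_pos_of_pos_of_lt_pi
      · rw [hθ]; positivity
      · have : 0 < θ := by rw [hθ]; positivity
        nlinarith
    rw [ht]
    set t := 2 * Real.cos (2 * θ)
    have key := fun n => S_cos (2 * θ) n
    rcases Nat.even_or_odd' (M i j) with ⟨k, hk | hk⟩
    · have z1 : (S ℝ (k - 1)).eval t = 0 := by
        have := key (k - 1)
        have e1 : (((k - 1 : ℤ) : ℝ) + 1) * (2 * θ) = Real.pi := by
          rw [← hmθ, hk]; push_cast; ring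
        rw [e1, Real.sin_pi] at this
        exact (mul_eq_zero.mp this).resolve_right hs
      have i1 : ((M i j : ℤ) - 2) / 2 = k - 1 := by omega
      have i2 : ((M i j : ℤ) - 1) / 2 = k - 1 := by omega
      rw [i1, i2, z1]; simp
    · have z1 : (S ℝ k).eval t + (S ℝ (k - 1)).eval t = 0 := by
        have h1 := key (k - 1)
        have h2 := key k
        have e1 : (((k - 1 : ℤ) : ℝ) + 1) * (2 * θ) = Real.pi - θ := by
          rw [← hmθ, hk]; push_cast; ring
        have e2 : (((k : ℤ) : ℝ) + 1) * (2 * θ) = Real.pi + θ := by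
          rw [← hmθ, hk]; push_cast; ring
        rw [e1, Real.sin_pi_sub] at h1
        rw [e2, add_comm, Real.sin_add_pi] at h2
        have : ((S ℝ k).eval t + (S ℝ (k - 1)).eval t) * Real.sin (2 * θ) = 0 := by
          rw [add_mul, h1, h2]; ring
        exact (mul_eq_zero.mp this).resolve_right hs
      have i1 : ((M i j : ℤ) - 3) / 2 = k - 1 := by omega
      have i2 : ((M i j : ℤ) - 1) / 2 = k := by omega
      have i3 : ((M i j : ℤ) - 2) / 2 = k - 1 := by omega
      have i4 : ((M i j : ℤ)) / 2 = k := by omega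
      rw [i1, i2, i3, i4, z1]; simp

variable {M} {W : Type*} [Group W] (cs : CoxeterSystem M W)

/-- geometric representation -/
noncomputable def rho : W →* ((B →₀ ℝ) ≃ₗ[ℝ] (B →₀ ℝ)) := cs.lift ⟨sig M, liftable M⟩

lemma rho_simple (i : B) : rho cs (cs.simple i) = sig M i := by
  rw [rho, cs.lift_apply_simple]

lemma rho_mul (u w : W) (v : B →₀ ℝ) : rho cs (u * w) v = rho cs u (rho cs w v) := by
  rw [map_mul]; rfl

lemma sig_e (i j : B) : sig M i (e j) = e j + (-2 * gc M i j) • e i := by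
  rw [sig_apply, bil_e]; module

lemma sig_self (i : B) : sig M i (e i) = - e i := by
  rw [sig_e, gc_self]; module

lemma rho_alt (s t : B) (k : ℕ) : rho cs (cs.wordProd (alternatingWord s t k)) (e s) =
    if Even k then cheb (-2 * gc M s t) (k + 1) • e s + cheb (-2 * gc M s t) k • e t
    else cheb (-2 * gc M s t) k • e s + cheb (-2 * gc M s t) (k + 1) • e t := by
  induction k with
  | zero => simp [alternatingWord, cheb]
  | succ k ih =>
    rw [alternatingWord_succ', cs.wordProd_cons, rho_mul, ih, rho_simple]
    by_cases hk : Even k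
    · have : ¬ Even (k + 1) := by rw [Nat.even_add_one]; simpa using hk
      rw [if_pos hk, if_pos hk, if_neg this, map_add, map_smul, map_smul, sig_self, sig_e,
        gc_symm M t s, show k + 1 + 1 = k + 2 from rfl, cheb]
      module
    · have : Even (k + 1) := by rw [Nat.even_add_one]; exact hk
      rw [if_neg hk, if_neg hk, if_pos this, map_add, map_smul, map_smul, sig_self, sig_e,
        show k + 1 + 1 = k + 2 from rfl, cheb]
      module

lemma strip (n : ℕ) : ∀ (w : W) (s t : B), cs.length w = n → ¬ cs.IsRightDescent w s →
    ∃ v k, w = v * cs.wordProd (alternatingWord s t k) ∧ cs.length w = cs.length v + k ∧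
      ¬ cs.IsRightDescent v s ∧ ¬ cs.IsRightDescent v t := by
  induction n with
  | zero =>
    intro w s t hw hs
    rw [cs.length_eq_zero_iff] at hw
    subst hw
    exact ⟨1, 0, by simp [alternatingWord], by simp, cs.not_isRightDescent_one _,
      cs.not_isRightDescent_one _⟩
  | succ n ih =>
    intro w s t hw hs
    by_cases ht : cs.IsRightDescent w t
    · have h1 := cs.isRightDescent_iff.mp ht
      have h2 := cs.isRightDescent_iff_not_isRightDescent_mul.mp ht
      obtain ⟨v, k, hv, hl, hvt, hvs⟩ := ih (w * cs.simple t) t s (by omega) h2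
      refine ⟨v, k + 1, ?_, by omega, hvs, hvt⟩
      rw [alternatingWord_succ, cs.wordProd_concat, ← mul_assoc, ← hv]
      simp
    · exact ⟨w, 0, by simp [alternatingWord], by simp, hs, ht⟩

lemma rho_nonneg (n : ℕ) : ∀ (w : W) (s : B), cs.length w = n → ¬ cs.IsRightDescent w s →
    ∀ k, 0 ≤ rho cs w (e s) k := by
  induction n using Nat.strong_induction_on with
  | _ n ih =>
    intro w s hw hs
    by_cases h1 : w = 1
    · subst h1
      intro k
      rw [map_one]
      change 0 ≤ (Finsupp.single s (1 : ℝ)) k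
      classical
      rw [Finsupp.single_apply]; split_ifs <;> norm_num
    obtain ⟨t, ht⟩ := cs.exists_rightDescent_of_ne_one h1
    have hst : s ≠ t := by rintro rfl; exact hs ht
    obtain ⟨v, k, hv, hl, hvs, hvt⟩ := strip cs n w s t hw hs
    have hk : k ≠ 0 := by
      rintro rfl
      simp [alternatingWord] at hv
      subst hv; exact hvt ht
    have hkm : M s t = 0 ∨ k + 1 ≤ M s t := by
      by_contra hcon
      push Not at hcon
      apply cs.not_isReduced_alternatingWord t s (m := k + 1) (by rw [M.symmetric]; exact hcon.1)
        (by rw [M.symmetric]; exact hcon.2)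
      have h2 := cs.not_isRightDescent_iff.mp hs
      have h3 : w * cs.simple s = v * cs.wordProd (alternatingWord t s (k + 1)) := by
        rw [alternatingWord_succ, cs.wordProd_concat, ← mul_assoc, ← hv]
      have h4 := cs.length_mul_le v (cs.wordProd (alternatingWord t s (k + 1)))
      rw [← h3] at h4
      have h5 := cs.length_wordProd_le (alternatingWord t s (k + 1))
      rw [CoxeterSystem.IsReduced]
      rw [length_alternatingWord] at *
      omega
    have ps := ih (cs.length v) (by omega) v s rfl hvs
    have pt := ih (cs.length v) (by omega) v t rfl hvt
    have c1 := cheb_nonneg M hst (k + 1) hkm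
    have c0 := cheb_nonneg M hst k (by omega)
    intro l
    rw [hv, rho_mul, rho_alt]
    split_ifs
    all_goals
      rw [map_add, map_smul, map_smul, Finsupp.add_apply, Finsupp.smul_apply, Finsupp.smul_apply]
      exact add_nonneg (mul_nonneg (by assumption) (ps l)) (mul_nonneg (by assumption) (pt l))

lemma rho_nonpos {w : W} {s : B} (hs : cs.IsRightDescent w s) (k : B) :
    rho cs w (e s) k ≤ 0 := by
  have h := rho_nonneg cs _ (w * cs.simple s) s rfl
    (cs.isRightDescent_iff_not_isRightDescent_mul.mp hs) k
  rw [rho_mul, rho_simple, sig_self, map_neg, Finsupp.neg_apply] at h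
  linarith

lemma bil_rho (w : W) (u v : B →₀ ℝ) : bil M (rho cs w u) (rho cs w v) = bil M u v := by
  induction w using cs.simple_induction_left with
  | one => simp
  | mul_simple_left w i ih => rw [rho_mul, rho_mul, rho_simple, bil_sig, ih]

lemma rho_outside {α : Set B} {w : W} (hw : w ∈ Subgroup.closure (cs.simple '' α)) :
    ∀ (v : B →₀ ℝ) (k : B), k ∉ α → rho cs w v k = v k := by
  induction hw using Subgroup.closure_induction with
  | mem x hx =>
    obtain ⟨i, hi, rfl⟩ := hx
    intro v k hk
    have : i ≠ k := by rintro rfl; exact hk hi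
    rw [rho_simple, sig_apply, Finsupp.sub_apply, Finsupp.smul_apply, e,
      Finsupp.single_eq_of_ne' this]
    simp
  | one => intro v k hk; simp
  | mul x y _ _ hx hy => intro v k hk; rw [rho_mul, hx _ _ hk, hy _ _ hk]
  | inv x _ hx =>
    intro v k hk
    rw [← hx _ _ hk, ← rho_mul]; simp

lemma longest_descent {α : Set B} {r : W} (hr : IsLongestOf cs α r) {i : B} (hi : i ∈ α) :
    cs.IsRightDescent r i := by
  have h := hr.2.1 (r * cs.simple i)
    (Subgroup.mul_mem _ hr.1 (Subgroup.subset_closure ⟨i, hi, rfl⟩))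
  exact lt_of_le_of_ne h (cs.length_mul_simple_ne r i)

lemma longest_sq {α : Set B} {r : W} (hr : IsLongestOf cs α r) : r * r = 1 := by
  have h := hr.2.2 r⁻¹ (Subgroup.inv_mem _ hr.1) (cs.length_inv r)
  nth_rw 1 [← h]
  simp

lemma vec_eq_sum (v : B →₀ ℝ) : v = ∑ k ∈ v.support, v k • e k := by
  conv_lhs => rw [← Finsupp.sum_single v]
  simp [Finsupp.sum, e]

/-- If the longest elements commute, `rα` fixes every `e j`, `j ∈ β`. -/
lemma fixes {α β : Set B} (hdisj : Disjoint α β) {rα rβ : W}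
    (hα : IsLongestOf cs α rα) (hβ : IsLongestOf cs β rβ) (hun : α ∪ β = Set.univ)
    (hc : rα * rβ = rβ * rα) {j : B} (hj : j ∈ β) : rho cs rα (e j) = e j := by
  have pos : ∀ k ∈ β, ∀ l, 0 ≤ rho cs rα (e k) l := by
    intro k hk l
    by_cases hd : cs.IsRightDescent rα k
    · exfalso
      have h1 := rho_nonpos cs hd k
      rw [rho_outside cs hα.1 _ k (fun h => Set.disjoint_left.mp hdisj h hk)] at h1
      simp [e] at h1
      linarith
    · exact rho_nonneg cs _ rα k rfl hd l
  have neg := fun l => rho_nonpos cs (longest_descent cs hβ hj) l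
  ext l
  by_cases hl : l ∈ α
  · have hlβ : l ∉ β := fun h => Set.disjoint_left.mp hdisj hl h
    have hlj : j ≠ l := by rintro rfl; exact hlβ hj
    rw [e, Finsupp.single_eq_of_ne' hlj]
    have h1 : rho cs rα (rho cs rβ (e j)) l = rho cs rα (e j) l := by
      rw [← rho_mul, hc, rho_mul, rho_outside cs hβ.1 _ l hlβ]
    have h2 : rho cs rα (rho cs rβ (e j)) l ≤ 0 := by
      set v := rho cs rβ (e j) with hv
      rw [vec_eq_sum v, map_sum, Finsupp.finsetSum_apply]
      apply Finset.sum_nonpos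
      intro k hk
      rw [map_smul, Finsupp.smul_apply]
      have hkβ : k ∈ β := by
        by_contra hkβ
        have h3 : v k = (e j : B →₀ ℝ) k := rho_outside cs hβ.1 _ k hkβ
        have : j ≠ k := by rintro rfl; exact hkβ hj
        rw [e, Finsupp.single_eq_of_ne' this] at h3
        exact (Finsupp.mem_support_iff.mp hk) h3
      exact mul_nonpos_of_nonpos_of_nonneg (neg k) (pos k hkβ l)
    have h3 := pos j hj l
    exact le_antisymm (h1 ▸ h2) h3
  · exact rho_outside cs hα.1 _ l hl

end CoxGeo

open CoxGeo in
/-- For a spherical 2-partition `{α, β}` of `I`, the order of `r_α r_β` is `2` iff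
every `i ∈ α` and `j ∈ β` satisfy `m_{i,j} = 2` (i.e. `Γ = Γ_α × Γ_β`). -/
theorem orderOf_eq_two_iff_product {B W : Type*} [Group W] {M : CoxeterMatrix B}
    (cs : CoxeterSystem M W)
    (α β : Set B) (hunion : α ∪ β = Set.univ) (hdisj : Disjoint α β)
    (hα : α.Nonempty) (hβ : β.Nonempty)
    (hsphα : IsSpherical cs α) (hsphβ : IsSpherical cs β)
    (rα rβ : W) (hrα : IsLongestOf cs α rα) (hrβ : IsLongestOf cs β rβ) :
    orderOf (rα * rβ) = 2 ↔ ∀ i ∈ α, ∀ j ∈ β, M.M i j = 2 := by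
  have sa := longest_sq cs hrα
  have sb := longest_sq cs hrβ
  have ia : rα⁻¹ = rα := inv_eq_of_mul_eq_one_left sa
  have ib : rβ⁻¹ = rβ := inv_eq_of_mul_eq_one_left sb
  constructor
  · intro ho i hi j hj
    have hsq : (rα * rβ) * (rα * rβ) = 1 := by rw [← pow_two, ← ho, pow_orderOf_eq_one]
    have hc : rα * rβ = rβ * rα := by
      rw [← inv_eq_of_mul_eq_one_left hsq, mul_inv_rev, ia, ib]
    have hij : i ≠ j := by rintro rfl; exact Set.disjoint_left.mp hdisj hi hj
    apply eq_two_of_gc M hij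
    apply le_antisymm (gc_nonpos M hij)
    have hf := fixes cs hdisj hrα hrβ hunion hc hj
    have h1 := bil_rho cs rα (e i) (e j)
    rw [hf, bil_e] at h1
    rw [← h1]
    set v := rho cs rα (e i) with hv
    rw [vec_eq_sum v, map_sum, LinearMap.sum_apply]
    apply Finset.sum_nonneg
    intro k hk
    have hkα : k ∈ α := by
      by_contra hkα
      have h3 : v k = (e i : B →₀ ℝ) k := rho_outside cs hrα.1 _ k hkα
      have : i ≠ k := by rintro rfl; exact hkα hi
      rw [e, Finsupp.single_eq_of_ne' this] at h3
      exact (Finsupp.mem_support_iff.mp hk) h3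
    have hkj : k ≠ j := by rintro rfl; exact Set.disjoint_left.mp hdisj hkα hj
    rw [map_smul, LinearMap.smul_apply, bil_e]
    exact mul_nonneg_of_nonpos_of_nonpos
      (rho_nonpos cs (longest_descent cs hrα hi) k) (gc_nonpos M hkj)
  · intro h
    have hsc : ∀ i ∈ α, ∀ j ∈ β, cs.simple i * cs.simple j = cs.simple j * cs.simple i := by
      intro i hi j hj
      have h1 := cs.simple_mul_simple_pow i j
      rw [h i hi j hj, pow_two] at h1
      rw [← inv_eq_of_mul_eq_one_left h1, mul_inv_rev, cs.inv_simple, cs.inv_simple]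
    have hc : Commute rα rβ := by
      have hle : Subgroup.closure (cs.simple '' α) ≤
          Subgroup.centralizer (cs.simple '' β) := by
        rw [Subgroup.closure_le]
        rintro _ ⟨i, hi, rfl⟩
        rw [SetLike.mem_coe, Subgroup.mem_centralizer_iff]
        rintro _ ⟨j, hj, rfl⟩
        exact (hsc i hi j hj).symm
      have hle2 : Subgroup.closure (cs.simple '' β) ≤ Subgroup.centralizer {rα} := by
        rw [Subgroup.closure_le]
        intro x hx
        rw [SetLike.mem_coe, Subgroup.mem_centralizer_iff]
        rintro _ rfl
        exact ((Subgroup.mem_centralizer_iff.mp (hle hrα.1)) x hx).symm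
      exact (Subgroup.mem_centralizer_iff.mp (hle2 hrβ.1)) rα rfl
    apply orderOf_eq_prime
    · rw [hc.mul_pow, pow_two, pow_two, sa, sb, one_mul]
    · intro h1
      have heq : rα = rβ := by
        rw [← ib]; exact eq_inv_of_mul_eq_one_left h1
      -- every coordinate is fixed by `rα`
      obtain ⟨i, hi⟩ := hα
      have h2 := rho_outside cs hrβ.1 (e i) i (fun hb => Set.disjoint_left.mp hdisj hi hb)
      have h3 := rho_nonpos cs (longest_descent cs hrα hi) i
      rw [heq, h2] at h3
      simp [e] at h3
      linarith
end

section
/- Let (W,S) be a Coxeter system indexed by I and let {α, β} be an admissible spherical 2-partition of I. If there exists i₀ ∈ α with m_{i₀,j} = 2 for all j ∈ β, then m_{i,j} = 2 for all i ∈ α and j ∈ β, and hence r_α r_β = r_β r_α. -/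
theorem funEnd_mul_apply {X : Type*} (f g : Function.End X) (p : X) : (f * g) p = f (g p) := rfl

theorem funEnd_one_apply {X : Type*} (p : X) : (1 : Function.End X) p = p := rfl

open Classical in
/-- Signed conjugation map on `W × ZMod 2`. -/
noncomputable def signedConj {B W : Type*} [Group W] {M : CoxeterMatrix B}
    (cs : CoxeterSystem M W) (i : B) : Function.End (W × ZMod 2) :=
  fun p => (cs.simple i * p.1 * cs.simple i, p.2 + if p.1 = cs.simple i then 1 else 0)

open Classical in
theorem signedConj_pow {B W : Type*} [Group W] {M : CoxeterMatrix B}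
    (cs : CoxeterSystem M W) (i j : B) (n : ℕ) (p : W × ZMod 2) :
    ((signedConj cs i * signedConj cs j) ^ n) p =
      ((cs.simple i * cs.simple j) ^ n * p.1 * ((cs.simple i * cs.simple j) ^ n)⁻¹,
        p.2 + ∑ k ∈ Finset.range (2 * n),
          if p.1 = cs.simple j * (cs.simple i * cs.simple j) ^ k then 1 else 0) := by
  have hinv : ∀ k : ℕ, ((cs.simple i * cs.simple j) ^ k)⁻¹ * cs.simple j =
      cs.simple j * (cs.simple i * cs.simple j) ^ k := by
    intro k
    induction k with
    | zero => simp
    | succ k ih =>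
      calc ((cs.simple i * cs.simple j) ^ (k + 1))⁻¹ * cs.simple j
          = (((cs.simple i * cs.simple j) ^ k)⁻¹ * cs.simple j) *
            (cs.simple i * cs.simple j) := by
            rw [pow_succ', mul_inv_rev, mul_inv_rev, cs.inv_simple, cs.inv_simple]
            simp only [mul_assoc]
        _ = cs.simple j * (cs.simple i * cs.simple j) ^ (k + 1) := by
            rw [ih, pow_succ, mul_assoc]
  induction n with
  | zero => simp [funEnd_one_apply]
  | succ n ih =>
    rw [pow_succ', funEnd_mul_apply, ih]
    set c := cs.simple i * cs.simple j with hc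
    rw [funEnd_mul_apply]
    simp only [signedConj]
    have h1 : (c ^ n * p.1 * (c ^ n)⁻¹ = cs.simple j) ↔ p.1 = cs.simple j * c ^ (2 * n) := by
      rw [two_mul, pow_add, ← mul_assoc, ← hinv n, mul_inv_eq_iff_eq_mul, ← eq_inv_mul_iff_mul_eq,
        mul_assoc]
    have h2 : (cs.simple j * (c ^ n * p.1 * (c ^ n)⁻¹) * cs.simple j = cs.simple i) ↔
        p.1 = cs.simple j * c ^ (2 * n + 1) := by
      have e : cs.simple j * c ^ (2 * n + 1) =
          (c ^ n)⁻¹ * (cs.simple j * cs.simple i * cs.simple j) * c ^ n := by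
        rw [mul_assoc (cs.simple j), ← hc, ← mul_assoc, hinv, two_mul, pow_succ, pow_add,
          mul_assoc, mul_assoc, mul_assoc, mul_assoc, ← pow_succ, pow_succ', hc]
        simp only [mul_assoc]
      rw [e]
      constructor
      · intro h
        rw [← h]
        simp [mul_assoc]
      · intro h
        rw [h]
        simp [mul_assoc]
    rw [show 2 * (n + 1) = 2 * n + 1 + 1 by ring, Finset.sum_range_succ, Finset.sum_range_succ]
    ext
    · simp only [hc, pow_succ', mul_inv_rev, cs.inv_simple, mul_assoc]
    · simp only [h1, h2]
      ring

theorem signedConj_liftable {B W : Type*} [Group W] {M : CoxeterMatrix B}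
    (cs : CoxeterSystem M W) : M.IsLiftable (signedConj cs) := by
  classical
  intro i j
  funext p
  rw [signedConj_pow]
  simp only [cs.simple_mul_simple_pow, two_mul, Finset.sum_range_add, pow_add, one_mul]
  rw [CharTwo.add_self_eq_zero]
  simp [funEnd_one_apply]

/-- The reflection cocycle: parity with which `t` occurs as an inversion of `w`. -/
noncomputable def refPar {B W : Type*} [Group W] {M : CoxeterMatrix B}
    (cs : CoxeterSystem M W) (w t : W) : ZMod 2 :=
  (cs.lift ⟨signedConj cs, signedConj_liftable cs⟩ w (t, 0)).2

section
variable {B W : Type*} [Group W] {M : CoxeterMatrix B} (cs : CoxeterSystem M W)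

theorem lift_signedConj (w t : W) (e : ZMod 2) :
    cs.lift ⟨signedConj cs, signedConj_liftable cs⟩ w (t, e) =
      (w * t * w⁻¹, e + refPar cs w t) := by
  unfold refPar
  induction w using cs.simple_induction_left generalizing t e with
  | one => simp [funEnd_one_apply]
  | mul_simple_left w i ih =>
    rw [map_mul, funEnd_mul_apply, funEnd_mul_apply, ih, ih t 0,
      cs.lift_apply_simple]
    simp [signedConj, mul_assoc, add_assoc]

theorem refPar_mul (u v t : W) :
    refPar cs (u * v) t = refPar cs v t + refPar cs u (v * t * v⁻¹) := by
  conv_lhs => unfold refPar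
  rw [map_mul, funEnd_mul_apply, lift_signedConj, lift_signedConj]
  simp

theorem refPar_one (t : W) : refPar cs 1 t = 0 := by simp [refPar, funEnd_one_apply]

open Classical in
theorem refPar_simple (i : B) (t : W) :
    refPar cs (cs.simple i) t = if t = cs.simple i then 1 else 0 := by
  unfold refPar
  rw [cs.lift_apply_simple]
  simp [signedConj]

theorem refPar_inv (u t : W) : refPar cs u⁻¹ t = refPar cs u (u⁻¹ * t * u) := by
  have h := refPar_mul cs u u⁻¹ t
  rw [mul_inv_cancel, refPar_one, inv_inv] at h
  exact CharTwo.add_eq_zero.mp h.symm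

theorem mem_of_refPar_ne_zero (γ : Set B) {u : W}
    (hu : u ∈ Subgroup.closure (cs.simple '' γ)) :
    ∀ t, refPar cs u t ≠ 0 → t ∈ Subgroup.closure (cs.simple '' γ) := by
  induction hu using Subgroup.closure_induction with
  | mem x hx =>
    obtain ⟨i, hi, rfl⟩ := hx
    intro t ht
    rw [refPar_simple] at ht
    have : t = cs.simple i := by
      by_contra h
      simp [h] at ht
    rw [this]
    exact Subgroup.subset_closure ⟨i, hi, rfl⟩
  | one => intro t ht; exact absurd (refPar_one cs t) ht
  | mul x y hx hy ihx ihy =>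
    intro t ht
    rw [refPar_mul] at ht
    by_cases h : refPar cs y t = 0
    · rw [h, zero_add] at ht
      have := ihx _ ht
      have h2 := mul_mem (mul_mem (inv_mem hy) this) hy
      simpa [mul_assoc] using h2
    · exact ihy _ h
  | inv x hx ih =>
    intro t ht
    rw [refPar_inv] at ht
    have h2 := mul_mem (mul_mem hx (ih _ ht)) (inv_mem hx)
    simpa [mul_assoc] using h2

theorem mem_ris_of_refPar (ω : List B) (t : W) (h : refPar cs (cs.wordProd ω) t ≠ 0) :
    t ∈ cs.rightInvSeq ω := by
  induction ω with
  | nil => simp [refPar_one] at h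
  | cons i ω ih =>
    rw [cs.wordProd_cons, refPar_mul, refPar_simple] at h
    simp only [CoxeterSystem.rightInvSeq, List.mem_cons]
    by_cases h1 : refPar cs (cs.wordProd ω) t = 0
    · left
      have : cs.wordProd ω * t * (cs.wordProd ω)⁻¹ = cs.simple i := by
        by_contra h2
        simp [h1, h2] at h
      rw [← this]
      simp [mul_assoc]
    · exact Or.inr (ih h1)

theorem length_lt_of_refPar (w t : W) (h : refPar cs w t ≠ 0) :
    cs.length (w * t) < cs.length w := by
  obtain ⟨ω, hω, rfl⟩ := cs.exists_isReduced w
  exact (cs.isRightInversion_of_mem_rightInvSeq hω (mem_ris_of_refPar cs ω t h)).2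

theorem refPar_of_length_lt (w : W) (i : B)
    (h : cs.length (w * cs.simple i) < cs.length w) : refPar cs w (cs.simple i) ≠ 0 := by
  intro h0
  have : refPar cs (w * cs.simple i) (cs.simple i) ≠ 0 := by
    rw [refPar_mul, refPar_simple]
    simp [h0]
  have := length_lt_of_refPar cs _ _ this
  simp at this
  omega
end

/-- Cartan-type coefficients of the geometric representation. -/
noncomputable def geoCoeff {B : Type*} (M : CoxeterMatrix B) (i j : B) : ℝ :=
  -2 * Real.cos (Real.pi / M i j)

/-- Coroot functional. -/
noncomputable def geoForm {B : Type*} (M : CoxeterMatrix B) (i : B) :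
    Module.Dual ℝ (B →₀ ℝ) :=
  Finsupp.linearCombination ℝ (fun j => geoCoeff M i j)

theorem geoForm_single {B : Type*} (M : CoxeterMatrix B) (i j : B) :
    geoForm M i (Finsupp.single j 1) = geoCoeff M i j := by
  simp [geoForm]

theorem geoForm_self {B : Type*} (M : CoxeterMatrix B) (i : B) :
    geoForm M i (Finsupp.single i 1) = 2 := by
  rw [geoForm_single]
  simp [geoCoeff]

/-- Simple reflections of the geometric representation. -/
noncomputable def geoRefl {B : Type*} (M : CoxeterMatrix B) (i : B) :
    (B →₀ ℝ) ≃ₗ[ℝ] (B →₀ ℝ) :=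
  Module.reflection (geoForm_self M i)

theorem geoRefl_liftable {B : Type*} (M : CoxeterMatrix B) : M.IsLiftable (geoRefl M) := by
  intro i j
  by_cases hij : i = j
  · subst hij
    simp only [CoxeterMatrix.diagonal, pow_one]
    ext1 z
    simp [geoRefl, LinearEquiv.mul_apply, Module.involutive_reflection _ _]
  have h1 := M.off_diagonal i j hij
  rcases Nat.eq_zero_or_pos (M i j) with h0 | hpos
  · rw [h0, pow_zero]
  have hsym : M j i = M i j := M.symmetric j i
  set m : ℕ := M i j with hm
  have ht : (2 * Real.cos (2 * Real.pi / m) : ℝ) =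
      geoForm M i (Finsupp.single j 1) * geoForm M j (Finsupp.single i 1) - 2 := by
    rw [geoForm_single, geoForm_single, geoCoeff, geoCoeff, hsym, ← hm,
      show 2 * Real.pi / m = 2 * (Real.pi / m) by ring, Real.cos_two_mul]
    ring
  apply LinearEquiv.ext
  intro z
  unfold geoRefl
  rw [Module.reflection_mul_reflection_pow_apply (geoForm_self M i) (geoForm_self M j) m z _ ht]
  by_cases hm2 : m = 2
  · have e1 : geoForm M i (Finsupp.single j 1) = 0 := by
      rw [geoForm_single, geoCoeff, ← hm, hm2]; simp
    have e2 : geoForm M j (Finsupp.single i 1) = 0 := by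
      rw [geoForm_single, geoCoeff, hsym, hm2]; simp
    rw [e1, e2, hm2]
    norm_num
    module
  have hm3 : 3 ≤ m := by omega
  have hm3' : (3 : ℝ) ≤ m := by exact_mod_cast hm3
  have hsin : Real.sin (2 * Real.pi / m) ≠ 0 := by
    apply ne_of_gt
    apply Real.sin_pos_of_pos_of_lt_pi
    · have := Real.pi_pos
      positivity
    · rw [div_lt_iff₀ (by linarith)]
      nlinarith [Real.pi_pos]
  have hS : ∀ n : ℤ, (Polynomial.Chebyshev.S ℝ n).eval (2 * Real.cos (2 * Real.pi / m)) *
      Real.sin (2 * Real.pi / m) = Real.sin ((n + 1) * (2 * Real.pi / m)) :=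
    fun n => Polynomial.Chebyshev.S_two_mul_real_cos _ n
  have hm0 : (m : ℝ) ≠ 0 := by linarith
  rcases Nat.even_or_odd' m with ⟨k, hk | hk⟩
  · have hk' : (m : ℝ) = 2 * k := by exact_mod_cast hk
    have z1 : (Polynomial.Chebyshev.S ℝ (k - 1 : ℤ)).eval
        (2 * Real.cos (2 * Real.pi / m)) = 0 := by
      have := hS (k - 1)
      rw [show (((k - 1 : ℤ) : ℝ) + 1) * (2 * Real.pi / m) = Real.pi by
        push_cast; rw [div_eq_mul_inv]; field_simp; rw [hk']; ring, Real.sin_pi] at this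
      exact (mul_eq_zero.mp this).resolve_right hsin
    rw [show ((m : ℤ) - 2) / 2 = k - 1 by omega, show ((m : ℤ) - 1) / 2 = k - 1 by omega, z1]
    simp
  · have hk' : (m : ℝ) = 2 * k + 1 := by exact_mod_cast hk
    have z1 : (Polynomial.Chebyshev.S ℝ (k : ℤ)).eval (2 * Real.cos (2 * Real.pi / m)) +
        (Polynomial.Chebyshev.S ℝ (k - 1 : ℤ)).eval (2 * Real.cos (2 * Real.pi / m)) = 0 := by
      have a := hS k
      have b := hS (k - 1)
      have c : Real.sin ((((k : ℤ) : ℝ) + 1) * (2 * Real.pi / m)) +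
          Real.sin ((((k - 1 : ℤ) : ℝ) + 1) * (2 * Real.pi / m)) = 0 := by
        have : (((k : ℤ) : ℝ) + 1) * (2 * Real.pi / m) =
            2 * Real.pi - (((k - 1 : ℤ) : ℝ) + 1) * (2 * Real.pi / m) := by
          push_cast; field_simp; rw [hk']; ring
        rw [this, Real.sin_two_pi_sub]
        ring
      rw [← a, ← b, ← add_mul] at c
      exact (mul_eq_zero.mp c).resolve_right hsin
    rw [show ((m : ℤ) - 2) / 2 = k - 1 by omega, show ((m : ℤ) - 1) / 2 = k by omega,
      show ((m : ℤ) - 3) / 2 = k - 1 by omega, show (m : ℤ) / 2 = k by omega, z1]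
    simp

/-- The geometric representation. -/
noncomputable def geoRep {B W : Type*} [Group W] {M : CoxeterMatrix B}
    (cs : CoxeterSystem M W) : W →* ((B →₀ ℝ) ≃ₗ[ℝ] (B →₀ ℝ)) :=
  cs.lift ⟨geoRefl M, geoRefl_liftable M⟩

section
variable {B W : Type*} [Group W] {M : CoxeterMatrix B} (cs : CoxeterSystem M W)

theorem geoRep_simple (i : B) (v : B →₀ ℝ) :
    geoRep cs (cs.simple i) v = v - geoForm M i v • Finsupp.single i 1 := by
  unfold geoRep
  rw [cs.lift_apply_simple, geoRefl, Module.reflection_apply]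

theorem geoRep_simple_self (i : B) :
    geoRep cs (cs.simple i) (Finsupp.single i 1) = - Finsupp.single i 1 := by
  rw [geoRep_simple, geoForm_self]
  module

theorem geoRep_apply_of_notMem (γ : Set B) {u : W}
    (hu : u ∈ Subgroup.closure (cs.simple '' γ)) :
    ∀ (v : B →₀ ℝ) (k : B), k ∉ γ → geoRep cs u v k = v k := by
  induction hu using Subgroup.closure_induction with
  | mem x hx =>
    obtain ⟨i, hi, rfl⟩ := hx
    intro v k hk
    have : i ≠ k := by rintro rfl; exact hk hi
    rw [geoRep_simple]
    simp [this]
  | one => intro v k hk; simp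
  | mul x y hx hy ihx ihy =>
    intro v k hk
    rw [map_mul, LinearEquiv.mul_apply, ihx _ _ hk, ihy _ _ hk]
  | inv x hx ih =>
    intro v k hk
    rw [← ih _ _ hk, ← LinearEquiv.mul_apply, ← map_mul]
    simp

/-- A reflection whose root is `x`, lying in `W_γ`, has `x` supported on `γ`. -/
theorem root_zero_of_mem (γ : Set B) (w : W) (j : B)
    (h : w * cs.simple j * w⁻¹ ∈ Subgroup.closure (cs.simple '' γ)) (k : B) (hk : k ∉ γ) :
    geoRep cs w (Finsupp.single j 1) k = 0 := by
  have h1 := geoRep_apply_of_notMem cs γ h (geoRep cs w (Finsupp.single j 1)) k hk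
  rw [← LinearEquiv.mul_apply, ← map_mul, inv_mul_cancel_right, map_mul, LinearEquiv.mul_apply,
    geoRep_simple_self, map_neg, Finsupp.neg_apply] at h1
  linarith

theorem conj_notMem (α β : Set B) (hdisj : Disjoint α β) (w : W) (j : B) (hj : j ∈ β)
    (hw : w ∈ Subgroup.closure (cs.simple '' β)) :
    w * cs.simple j * w⁻¹ ∉ Subgroup.closure (cs.simple '' α) := by
  intro h
  have hz : geoRep cs w (Finsupp.single j 1) = 0 := by
    ext k
    by_cases hk : k ∈ α
    · have hkβ : k ∉ β := Set.disjoint_left.mp hdisj hk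
      rw [geoRep_apply_of_notMem cs β hw _ k hkβ]
      have : j ≠ k := by rintro rfl; exact hkβ hj
      simp [this]
    · exact root_zero_of_mem cs α w j h k hk
  rw [LinearEquiv.map_eq_zero_iff] at hz
  simp at hz

theorem eq_two_of_conj_mem (β : Set B) (i j : B) (hi : i ∉ β) (hj : j ∈ β)
    (h : cs.simple i * cs.simple j * (cs.simple i)⁻¹ ∈ Subgroup.closure (cs.simple '' β)) :
    M i j = 2 := by
  have h1 := root_zero_of_mem cs β _ j h i hi
  have hij : i ≠ j := by rintro rfl; exact hi hj
  rw [geoRep_simple, geoForm_single] at h1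
  have hc : Real.cos (Real.pi / M i j) = 0 := by
    simpa [geoCoeff, hij.symm, Finsupp.single_apply] using h1
  have h2 := M.off_diagonal i j hij
  by_contra h3
  have hlt : 0 < Real.cos (Real.pi / M i j) := by
    rcases Nat.eq_zero_or_pos (M i j) with h0 | hpos
    · rw [h0]; simp
    · have h4 : 3 ≤ M i j := by
        have : M i j ≠ 1 := h2
        omega
      have h5 : (3 : ℝ) ≤ M i j := by exact_mod_cast h4
      have := Real.pi_pos
      apply Real.cos_pos_of_mem_Ioo
      constructor
      · have : 0 < Real.pi / M i j := by positivity
        linarith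
      · rw [div_lt_iff₀ (by linarith)]
        nlinarith
  linarith
end

/-- If `{α, β}` is an admissible spherical 2-partition and some `i₀ ∈ α` satisfies
`m_{i₀,j} = 2` for all `j ∈ β`, then `m_{i,j} = 2` for all `i ∈ α`, `j ∈ β`, and
`r_α r_β = r_β r_α`. -/
theorem product_of_admissible_with_central_vertex {B W : Type*} [Group W]
    {M : CoxeterMatrix B} (cs : CoxeterSystem M W)
    (α β : Set B) (hunion : α ∪ β = Set.univ) (hdisj : Disjoint α β)
    (hα : α.Nonempty) (hβ : β.Nonempty)
    (hsphα : IsSpherical cs α) (hsphβ : IsSpherical cs β)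
    (rα rβ : W) (hrα : IsLongestOf cs α rα) (hrβ : IsLongestOf cs β rβ)
    (hadm : ∀ w ∈ Subgroup.closure ({rα, rβ} : Set W), ∀ γ ∈ ({α, β} : Set (Set B)),
      (∀ i ∈ γ, cs.length (w * cs.simple i) = cs.length w + 1) ∨
      (∀ i ∈ γ, cs.length (w * cs.simple i) + 1 = cs.length w))
    (hi0 : ∃ i0 ∈ α, ∀ j ∈ β, M.M i0 j = 2) :
    (∀ i ∈ α, ∀ j ∈ β, M.M i j = 2) ∧ rα * rβ = rβ * rα := by
  classical
  obtain ⟨i0, hi0α, hi0⟩ := hi0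
  have comm : ∀ i j, M.M i j = 2 → cs.simple i * cs.simple j = cs.simple j * cs.simple i := by
    intro i j h
    have h1 := cs.simple_mul_simple_pow i j
    rw [h, pow_two, mul_eq_one_iff_eq_inv] at h1
    simpa using h1
  -- elements of `W_γ` commute with `x` as soon as the generators do
  have commcl : ∀ (γ : Set B) (x : W), (∀ j ∈ γ, x * cs.simple j = cs.simple j * x) →
      ∀ u ∈ Subgroup.closure (cs.simple '' γ), x * u = u * x := by
    intro γ x hx u hu
    have : Subgroup.closure (cs.simple '' γ) ≤ Subgroup.centralizer {x} := by
      rw [Subgroup.closure_le]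
      rintro _ ⟨j, hj, rfl⟩
      exact Subgroup.mem_centralizer_iff.mpr (by rintro y rfl; exact hx j hj)
    exact Subgroup.mem_centralizer_iff.mp (this hu) x rfl
  have sα : ∀ i ∈ α, cs.simple i ∈ Subgroup.closure (cs.simple '' α) :=
    fun i hi => Subgroup.subset_closure ⟨i, hi, rfl⟩
  have sβ : ∀ i ∈ β, cs.simple i ∈ Subgroup.closure (cs.simple '' β) :=
    fun i hi => Subgroup.subset_closure ⟨i, hi, rfl⟩
  -- simple reflections are inversions of the longest elements
  have desc : ∀ (γ : Set B) (r : W), IsLongestOf cs γ r → ∀ i ∈ γ,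
      refPar cs r (cs.simple i) ≠ 0 := by
    intro γ r hr i hi
    apply refPar_of_length_lt
    exact lt_of_le_of_ne
      (hr.2.1 _ (mul_mem hr.1 (Subgroup.subset_closure ⟨i, hi, rfl⟩)))
      (cs.length_mul_simple_ne r i)
  have notβ : ∀ i ∈ α, refPar cs rβ (cs.simple i) = 0 := by
    intro i hi
    by_contra h
    have h1 := mem_of_refPar_ne_zero cs β hrβ.1 _ h
    exact conj_notMem cs β α hdisj.symm 1 i hi (one_mem _) (by simpa using h1)
  have hinvβ : rβ⁻¹ = rβ := hrβ.2.2 _ (inv_mem hrβ.1) (cs.length_inv rβ)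
  -- Step 1
  have step1 : cs.length (rα * rβ * cs.simple i0) < cs.length (rα * rβ) := by
    apply length_lt_of_refPar
    have hc := commcl β (cs.simple i0) (fun j hj => comm i0 j (hi0 j hj)) rβ hrβ.1
    rw [refPar_mul, notβ i0 hi0α, zero_add, ← hc, mul_inv_cancel_right]
    exact desc α rα hrα i0 hi0α
  -- Step 2
  have step2 : ∀ i ∈ α, rβ * cs.simple i * rβ⁻¹ ∈ Subgroup.closure (cs.simple '' α) := by
    intro i hi
    rcases hadm (rα * rβ) (mul_mem (Subgroup.subset_closure (by simp))
      (Subgroup.subset_closure (by simp))) α (by simp) with h | h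
    · have := h i0 hi0α
      omega
    · have h1 := h i hi
      have h2 := refPar_of_length_lt cs (rα * rβ) i (by omega)
      rw [refPar_mul, notβ i hi, zero_add] at h2
      exact mem_of_refPar_ne_zero cs α hrα.1 _ h2
  -- Step 3
  have main : ∀ i ∈ α, ∀ j ∈ β, M.M i j = 2 := by
    intro i hi j hj
    have hiβ : i ∉ β := Set.disjoint_left.mp hdisj hi
    set t := rβ * cs.simple i * rβ⁻¹ with ht
    have h1 : refPar cs (t * rβ) (cs.simple j) ≠ 0 := by
      have h0 : refPar cs t (rβ * cs.simple j * rβ⁻¹) = 0 := by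
        by_contra h
        exact conj_notMem cs α β hdisj rβ j hj hrβ.1
          (mem_of_refPar_ne_zero cs α (step2 i hi) _ h)
      rw [refPar_mul, h0, add_zero]
      exact desc β rβ hrβ j hj
    rw [ht, inv_mul_cancel_right, refPar_mul, refPar_simple] at h1
    have hne : cs.simple j ≠ cs.simple i := by
      intro h
      exact conj_notMem cs α β hdisj 1 j hj (one_mem _) (by simpa [h] using sα i hi)
    rw [if_neg hne, zero_add] at h1
    exact eq_two_of_conj_mem cs β i j hiβ hj (mem_of_refPar_ne_zero cs β hrβ.1 _ h1)
  refine ⟨main, ?_⟩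
  refine commcl β rα (fun j hj => ?_) rβ hrβ.1
  exact (commcl α (cs.simple j) (fun i hi => (comm i j (main i hi j hj)).symm) rα hrα.1).symm
end

section
/- Let Γ be a Coxeter matrix over I and G ≤ Aut(Γ). Every G-fixed element x of the Artin–Tits monoid B⁺_Γ lies in the submonoid generated by the elements r_α, where α ranges over the spherical orbits of I under G and r_α denotes the Garside-type lcm element (the lift of the longest element of W_α) in B⁺_Γ. -/
open CoxeterSystem

/-- The braid relations of the Artin–Tits monoid of a Coxeter matrix `M`
(`M.M i j = 0` encodes `m_{i,j} = ∞`). -/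
def braidRels {B : Type*} (M : CoxeterMatrix B) :
    FreeMonoid B → FreeMonoid B → Prop := fun a b =>
  ∃ i j : B, M.M i j ≠ 0 ∧
    a = FreeMonoid.ofList (alternatingWord i j (M.M i j)) ∧
    b = FreeMonoid.ofList (alternatingWord j i (M.M i j))

/-- The Artin–Tits monoid of a Coxeter matrix `M`. -/
def ArtinTitsMonoid {B : Type*} (M : CoxeterMatrix B) := PresentedMonoid (braidRels M)

instance {B : Type*} (M : CoxeterMatrix B) : Monoid (ArtinTitsMonoid M) :=
  inferInstanceAs (Monoid (PresentedMonoid (braidRels M)))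

/-- The generator of the Artin–Tits monoid at index `i`. -/
def ArtinTitsMonoid.sigma {B : Type*} (M : CoxeterMatrix B) (i : B) : ArtinTitsMonoid M :=
  PresentedMonoid.of (braidRels M) i

/-- `a` left-divides `b`. -/
def LeftDvd {M : Type*} [Monoid M] (a b : M) : Prop := ∃ c, b = a * c

/-- `m` is a right lcm of the set `X`. -/
def IsRightLcmOf {M : Type*} [Monoid M] (X : Set M) (m : M) : Prop :=
  (∀ x ∈ X, LeftDvd x m) ∧ ∀ z, (∀ x ∈ X, LeftDvd x z) → LeftDvd m z


namespace ATM

open CoxeterSystem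

/-- cosine attached to a Coxeter matrix entry. -/
noncomputable def cc (m : ℕ) : ℝ := if m = 0 then 1 else Real.cos (Real.pi / m)

/-- normalized sines. -/
noncomputable def pp (m k : ℕ) : ℝ :=
  if m = 0 then (k : ℝ) else Real.sin (k * (Real.pi / m)) / Real.sin (Real.pi / m)

lemma sin_pos_of_two_le {m : ℕ} (hm : 2 ≤ m) : 0 < Real.sin (Real.pi / m) := by
  have h2 : (2 : ℝ) ≤ m := by exact_mod_cast hm
  apply Real.sin_pos_of_pos_of_lt_pi
  · have := Real.pi_pos; positivity
  · rw [div_lt_iff₀ (by linarith)]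
    nlinarith [Real.pi_pos]

lemma pp_zero (m : ℕ) : pp m 0 = 0 := by simp [pp]

lemma pp_one {m : ℕ} (hm : m ≠ 1) : pp m 1 = 1 := by
  unfold pp
  split_ifs with h
  · simp
  · have := sin_pos_of_two_le (m := m) (by omega)
    simp [this.ne']

lemma pp_rec (m k : ℕ) : pp m (k + 2) = 2 * cc m * pp m (k + 1) - pp m k := by
  unfold pp cc
  split_ifs with h
  · push_cast; ring
  · have e1 : ((k + 2 : ℕ) : ℝ) * (Real.pi / m) =
        ((k + 1 : ℕ) : ℝ) * (Real.pi / m) + Real.pi / m := by push_cast; ring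
    have e2 : (k : ℝ) * (Real.pi / m) =
        ((k + 1 : ℕ) : ℝ) * (Real.pi / m) - Real.pi / m := by push_cast; ring
    rw [e1, e2, Real.sin_add, Real.sin_sub]
    ring

lemma pp_nonneg {m k : ℕ} (hm : m ≠ 1) (hk : m ≠ 0 → k ≤ m) : 0 ≤ pp m k := by
  unfold pp
  split_ifs with h
  · positivity
  · have h1 := sin_pos_of_two_le (m := m) (by omega)
    apply div_nonneg _ h1.le
    have hm0 : (0 : ℝ) < m := by positivity
    have hk' : (k : ℝ) ≤ m := by exact_mod_cast hk h
    apply Real.sin_nonneg_of_nonneg_of_le_pi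
    · have := Real.pi_pos; positivity
    · calc (k : ℝ) * (Real.pi / m) ≤ m * (Real.pi / m) := by
            have := Real.pi_pos
            gcongr
        _ = Real.pi := by field_simp

lemma pp_two_mul {m : ℕ} (hm : 2 ≤ m) : pp m (2 * m) = 0 ∧ pp m (2 * m + 1) = 1 := by
  have h0 : m ≠ 0 := by omega
  have h1 := sin_pos_of_two_le hm
  have hm0 : (m : ℝ) ≠ 0 := by exact_mod_cast h0
  unfold pp
  rw [if_neg h0, if_neg h0]
  have e1 : ((2 * m : ℕ) : ℝ) * (Real.pi / m) = 2 * Real.pi := by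
    push_cast; field_simp
  have e2 : ((2 * m + 1 : ℕ) : ℝ) * (Real.pi / m) = Real.pi / m + 2 * Real.pi := by
    push_cast; field_simp; ring
  rw [e1, e2, Real.sin_two_pi, Real.sin_add_two_pi]
  exact ⟨by simp, div_self h1.ne'⟩

lemma cc_sq_ne {m : ℕ} (hm : 2 ≤ m) : 1 - cc m ^ 2 ≠ 0 := by
  have h0 : m ≠ 0 := by omega
  have h1 := sin_pos_of_two_le hm
  unfold cc
  rw [if_neg h0, ← Real.sin_sq]
  positivity

section geom

variable {B : Type*} (M : CoxeterMatrix B)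

/-- simple roots -/
noncomputable def rt (i : B) : B →₀ ℝ := Finsupp.single i 1

/-- coroots -/
noncomputable def crt (i : B) : (B →₀ ℝ) →ₗ[ℝ] ℝ :=
  Finsupp.linearCombination ℝ (fun j => - 2 * cc (M.M i j))

lemma crt_rt (i j : B) : crt M i (rt j) = - 2 * cc (M.M i j) := by
  simp [crt, rt]

/-- simple reflections on the geometric representation. -/
noncomputable def refl (i : B) : Module.End ℝ (B →₀ ℝ) :=
  LinearMap.id - (crt M i).smulRight (rt i)

lemma refl_apply (i : B) (v : B →₀ ℝ) : refl M i v = v - crt M i v • rt i := by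
  simp [refl]

lemma cc_diag (i : B) : cc (M.M i i) = -1 := by
  simp [cc]

lemma refl_rt (i j : B) : refl M i (rt j) = rt j + (2 * cc (M.M i j)) • rt i := by
  rw [refl_apply, crt_rt, sub_eq_add_neg, ← neg_smul]; simp

lemma refl_self (i : B) : refl M i (rt i) = - rt i := by
  rw [refl_rt, cc_diag]; module

lemma refl_sq (i : B) : refl M i * refl M i = 1 := by
  refine LinearMap.ext fun v => ?_
  simp only [Module.End.mul_apply, Module.End.one_apply]
  rw [refl_apply M i v, map_sub, map_smul, refl_self, refl_apply]
  module

lemma pow_apply_rt (i j : B) (hij : i ≠ j) (k : ℕ) :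
    ((refl M i * refl M j) ^ k) (rt i) =
      pp (M.M i j) (2 * k + 1) • rt i + pp (M.M i j) (2 * k) • rt j := by
  have h1 : M.M i j ≠ 1 := M.off_diagonal i j hij
  have hs : M.M j i = M.M i j := M.symmetric j i
  induction k with
  | zero => simp [pp_zero, pp_one h1]
  | succ k ih =>
    rw [pow_succ', Module.End.mul_apply, ih, Module.End.mul_apply]
    simp only [map_add, map_smul, refl_self, refl_rt, hs, map_neg]
    rw [show 2 * (k + 1) + 1 = (2 * k + 1) + 2 by ring, pp_rec,
      show 2 * k + 1 + 1 = 2 * k + 2 by ring, show 2 * (k + 1) = 2 * k + 2 by ring, pp_rec]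
    module

lemma liftable : M.IsLiftable (refl M) := by
  intro i j
  change (refl M i * refl M j) ^ M.M i j = 1
  rcases eq_or_ne i j with rfl | hij
  · rw [refl_sq, one_pow]
  have h1 : M.M i j ≠ 1 := M.off_diagonal i j hij
  have hs : M.M j i = M.M i j := M.symmetric j i
  rcases Nat.eq_zero_or_pos (M.M i j) with h0 | h0
  · rw [h0, pow_zero]
  have hm : 2 ≤ M.M i j := by omega
  have key : ∀ i j : B, i ≠ j → 2 ≤ M.M i j →
      ((refl M i * refl M j) ^ M.M i j) (rt i) = rt i := by
    intro i j hij hm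
    rw [pow_apply_rt M i j hij, (pp_two_mul hm).1, (pp_two_mul hm).2]; simp
  have inv : ∀ k, (refl M i * refl M j) ^ k * (refl M j * refl M i) ^ k = 1 := by
    intro k
    induction k with
    | zero => simp
    | succ k ih =>
      rw [pow_succ, pow_succ']
      calc _ = (refl M i * refl M j) ^ k * (refl M i * (refl M j * refl M j) * refl M i)
            * (refl M j * refl M i) ^ k := by simp only [mul_assoc]
        _ = 1 := by rw [refl_sq, mul_one, refl_sq, mul_one, ih]
  have ki := key i j hij hm
  have kj : ((refl M i * refl M j) ^ M.M i j) (rt j) = rt j := by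
    have h := key j i hij.symm (hs ▸ hm)
    rw [hs] at h
    conv_lhs => rw [← h]
    rw [← Module.End.mul_apply, inv, Module.End.one_apply]
  refine LinearMap.ext fun v => ?_
  rw [Module.End.one_apply]
  -- decompose
  have hne := cc_sq_ne hm
  set c := cc (M.M i j) with hc
  obtain ⟨a, b, ha, hb⟩ : ∃ a b : ℝ, crt M i v = 2 * a - 2 * c * b ∧
      crt M j v = 2 * b - 2 * c * a := by
    refine ⟨(crt M i v + c * crt M j v) / (2 * (1 - c ^ 2)),
      (crt M j v + c * crt M i v) / (2 * (1 - c ^ 2)), ?_, ?_⟩ <;> field_simp <;> ring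
  have hv : v = (v - a • rt i - b • rt j) + (a • rt i + b • rt j) := by abel
  have hfi : refl M i (v - a • rt i - b • rt j) = v - a • rt i - b • rt j := by
    rw [refl_apply]
    simp only [map_sub, map_smul, crt_rt, cc_diag, smul_eq_mul, ha, ← hc]
    module
  have hfj : refl M j (v - a • rt i - b • rt j) = v - a • rt i - b • rt j := by
    rw [refl_apply]
    simp only [map_sub, map_smul, crt_rt, cc_diag, smul_eq_mul, hb, hs, ← hc]
    module
  have hf : ∀ k, ((refl M i * refl M j) ^ k) (v - a • rt i - b • rt j) =
      v - a • rt i - b • rt j := by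
    intro k
    induction k with
    | zero => simp
    | succ k ih => rw [pow_succ, Module.End.mul_apply, Module.End.mul_apply, hfj, hfi, ih]
  conv_lhs => rw [hv]
  rw [map_add, hf, map_add, map_smul, map_smul, ki, kj]
  abel

end geom

section cox

variable {B : Type*} {M : CoxeterMatrix B} {W : Type*} [Group W] (cs : CoxeterSystem M W)

/-- geometric representation -/
noncomputable def rep : W →* Module.End ℝ (B →₀ ℝ) := cs.lift ⟨refl M, liftable M⟩

lemma rep_simple (i : B) : rep cs (cs.simple i) = refl M i := cs.lift_apply_simple _ _

lemma rep_inv_apply (w : W) (v : B →₀ ℝ) : rep cs w⁻¹ (rep cs w v) = v := by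
  rw [← Module.End.mul_apply, ← map_mul]; simp

/-- product of the alternating word `... i j` of length `k` (ends in `j`). -/
def A (i j : B) (k : ℕ) : W := cs.wordProd (alternatingWord i j k)

lemma A_zero (i j : B) : A cs i j 0 = 1 := by simp [A, alternatingWord]

lemma A_succ (i j : B) (k : ℕ) : A cs i j (k + 1) = A cs j i k * cs.simple j := by
  rw [A, alternatingWord_succ, wordProd_concat]; rfl

lemma A_succ' (i j : B) (k : ℕ) :
    A cs i j (k + 1) = cs.simple (if Even k then j else i) * A cs i j k := by
  rw [A, alternatingWord_succ', wordProd_cons]; rfl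

lemma Msymm (i j : B) : M.M j i = M.M i j := M.symmetric j i

lemma A_braid (i j : B) : A cs i j (M.M i j) = A cs j i (M.M i j) := by
  have := cs.wordProd_braidWord_eq i j
  unfold braidWord at this
  have h : M.M j i = M.M i j := Msymm i j
  change cs.wordProd (alternatingWord i j (M.M i j)) = cs.wordProd (alternatingWord j i (M.M j i)) at this
  rw [h] at this
  exact this

lemma rep_A (i j : B) (hij : i ≠ j) (k : ℕ) :
    rep cs (A cs i j k) (rt i) =
      pp (M.M i j) (k + 1) • rt (if Even k then i else j) +
      pp (M.M i j) k • rt (if Even k then j else i) := by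
  have h1 : M.M i j ≠ 1 := M.off_diagonal i j hij
  have hs : M.M j i = M.M i j := Msymm i j
  induction k with
  | zero => simp [pp_zero, pp_one h1, A_zero]
  | succ k ih =>
    rw [A_succ', map_mul, Module.End.mul_apply, ih, rep_simple, pp_rec]
    by_cases hk : Even k
    · have hk' : ¬ Even (k + 1) := by simpa [Nat.even_add_one] using hk
      simp only [hk, hk', if_true, if_false, map_add, map_smul, refl_self, refl_rt, hs]
      module
    · have hk' : Even (k + 1) := by simpa [Nat.even_add_one] using hk
      simp only [hk, hk', if_true, if_false, map_add, map_smul, refl_self, refl_rt]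
      module

/-- nonnegative vectors -/
def Pos (v : B →₀ ℝ) : Prop := ∀ b, 0 ≤ v b

lemma Pos.comb {v w : B →₀ ℝ} (hv : Pos v) (hw : Pos w) {a b : ℝ} (ha : 0 ≤ a) (hb : 0 ≤ b) :
    Pos (a • v + b • w) := by
  intro x
  have h1 := hv x
  have h2 := hw x
  simp only [Finsupp.coe_add, Finsupp.coe_smul, Pi.add_apply, Pi.smul_apply, smul_eq_mul]
  positivity

lemma pos_A {v : W} {i j : B} (hij : i ≠ j) {k : ℕ} (hk : M.M i j ≠ 0 → k < M.M i j)
    (hi : Pos (rep cs v (rt i))) (hj : Pos (rep cs v (rt j))) :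
    Pos (rep cs (v * A cs i j k) (rt i)) := by
  have h1 : M.M i j ≠ 1 := M.off_diagonal i j hij
  rw [map_mul, Module.End.mul_apply, rep_A cs i j hij, map_add, map_smul, map_smul]
  apply Pos.comb
  · split_ifs <;> assumption
  · split_ifs <;> assumption
  · exact pp_nonneg h1 (fun h => hk h)
  · exact pp_nonneg h1 (fun h => (hk h).le)

/-- right ascent -/
def Asc (w : W) (i : B) : Prop := cs.length (w * cs.simple i) = cs.length w + 1

lemma not_asc {w : W} {i : B} (h : ¬ Asc cs w i) : cs.length (w * cs.simple i) + 1 = cs.length w := by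
  rcases cs.length_mul_simple w i with h' | h'
  · exact absurd h' h
  · exact h'

lemma length_A_le (i j : B) (k : ℕ) : cs.length (A cs i j k) ≤ k := by
  have := cs.length_wordProd_le (alternatingWord i j k)
  rwa [length_alternatingWord] at this

lemma strip (w : W) (i j : B) (hj : ¬ Asc cs w j) :
    ∃ (v : W) (k : ℕ), 1 ≤ k ∧ w = v * A cs i j k ∧ cs.length w = cs.length v + k ∧
      Asc cs v i ∧ Asc cs v j := by
  induction h : cs.length w using Nat.strong_induction_on generalizing w i j with
  | _ n ih =>
    have hl := not_asc cs hj
    have hja : Asc cs (w * cs.simple j) j := by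
      unfold Asc; simp; omega
    by_cases hi : Asc cs (w * cs.simple j) i
    · refine ⟨w * cs.simple j, 1, le_rfl, ?_, by omega, hi, hja⟩
      simp [A_succ, A_zero]
    · obtain ⟨v, k, hk, e, l, a1, a2⟩ := ih _ (by omega) (w * cs.simple j) j i hi rfl
      refine ⟨v, k + 1, by omega, ?_, by omega, a2, a1⟩
      rw [A_succ, ← mul_assoc, ← e]; simp

lemma A_add (i j : B) (k m : ℕ) : ∃ u, A cs i j (k + m) = u * A cs i j m ∧ cs.length u ≤ k := by
  induction m generalizing i j with
  | zero => exact ⟨A cs i j k, by simp [A_zero], length_A_le cs i j k⟩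
  | succ m ih =>
    obtain ⟨u, hu, hl⟩ := ih j i
    refine ⟨u, ?_, hl⟩
    rw [← add_assoc, A_succ, hu, A_succ, mul_assoc]

lemma asc_pos (w : W) (i : B) (h : Asc cs w i) : Pos (rep cs w (rt i)) := by
  induction hn : cs.length w using Nat.strong_induction_on generalizing w i with
  | _ n ih =>
    by_cases hw : w = 1
    · subst hw
      intro b
      classical
      simp only [map_one, Module.End.one_apply, rt, Finsupp.single_apply]
      split_ifs <;> norm_num
    obtain ⟨j, hj⟩ := cs.exists_rightDescent_of_ne_one hw
    have hj' : ¬ Asc cs w j := by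
      unfold IsRightDescent at hj; unfold Asc; omega
    have hij : i ≠ j := by rintro rfl; exact hj' h
    obtain ⟨v, k, hk, e, l, a1, a2⟩ := strip cs w i j hj'
    rw [e]
    apply pos_A cs hij
    · intro hm
      by_contra hlt
      push Not at hlt
      obtain ⟨d, hd⟩ := Nat.exists_eq_add_of_le hlt
      obtain ⟨u, hu, hul⟩ := A_add cs i j d (M.M i j)
      rw [add_comm, ← hd] at hu
      obtain ⟨m, hm'⟩ := Nat.exists_eq_succ_of_ne_zero hm
      have : w * cs.simple i = v * (u * A cs i j m) := by
        rw [e, hu, A_braid, hm', Nat.succ_eq_add_one, A_succ]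
        simp [mul_assoc]
      have h1 := cs.length_mul_le v (u * A cs i j m)
      have h2 := cs.length_mul_le u (A cs i j m)
      have h3 := length_A_le cs i j m
      unfold Asc at h
      rw [this] at h
      omega
    · exact ih _ (by omega) v i a1 rfl
    · exact ih _ (by omega) v j a2 rfl

lemma pos_asc (w : W) (i : B) (h : Pos (rep cs w (rt i))) : Asc cs w i := by
  by_contra hn
  have hl := not_asc cs hn
  have ha : Asc cs (w * cs.simple i) i := by unfold Asc; simp; omega
  have hp := asc_pos cs _ _ ha
  rw [map_mul, Module.End.mul_apply, rep_simple, refl_self, map_neg] at hp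
  have h0 : rep cs w (rt i) = 0 := by
    ext b
    have h1 := h b
    have h2 := hp b
    simp only [Finsupp.coe_neg, Pi.neg_apply] at h2
    simp only [Finsupp.coe_zero, Pi.zero_apply]
    linarith
  have h1 := rep_inv_apply cs w (rt i)
  rw [h0, map_zero] at h1
  have := DFunLike.congr_fun h1 i
  simp [rt] at this

/-- (W2) -/
lemma length_mul_A {v : W} {i j : B} (hij : i ≠ j) (hi : Asc cs v i) (hj : Asc cs v j)
    (k : ℕ) (hk : M.M i j ≠ 0 → k ≤ M.M i j) :
    cs.length (v * A cs i j k) = cs.length v + k := by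
  induction k generalizing i j with
  | zero => simp [A_zero]
  | succ k ih =>
    have hs : M.M j i = M.M i j := Msymm i j
    have := ih hij.symm hj hi (by rw [hs]; intro h; have := hk h; omega)
    have hp := pos_asc cs _ _ (pos_A cs (v := v) hij.symm (k := k)
      (by rw [hs]; intro h; have := hk h; omega) (asc_pos cs _ _ hj) (asc_pos cs _ _ hi))
    unfold Asc at hp
    rw [A_succ, ← mul_assoc, hp, this, add_assoc]

/-- (W1), right version -/
lemma two_desc {w : W} {i j : B} (hij : i ≠ j) (hi : ¬ Asc cs w i) (hj : ¬ Asc cs w j) :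
    M.M i j ≠ 0 ∧ ∃ v, w = v * A cs i j (M.M i j) ∧ cs.length w = cs.length v + M.M i j := by
  obtain ⟨v, k, hk, e, l, a1, a2⟩ := strip cs w i j hj
  by_cases hlt : M.M i j ≠ 0 → k < M.M i j
  · exfalso
    apply hi
    apply pos_asc
    rw [e]
    exact pos_A cs hij hlt (asc_pos cs _ _ a1) (asc_pos cs _ _ a2)
  · push Not at hlt
    obtain ⟨hm, hlt⟩ := hlt
    obtain ⟨d, hd⟩ := Nat.exists_eq_add_of_le hlt
    obtain ⟨u, hu, hul⟩ := A_add cs i j d (M.M i j)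
    rw [add_comm, ← hd] at hu
    refine ⟨hm, v * u, by rw [e, hu, mul_assoc], ?_⟩
    have h1 := cs.length_mul_le v u
    have h2 := cs.length_mul_le (v * u) (A cs i j (M.M i j))
    have h3 := length_A_le cs i j (M.M i j)
    rw [mul_assoc, ← hu, ← e] at h2
    omega

end cox

end ATM


namespace ATM

open CoxeterSystem

section words

variable {B : Type*}

/-- alternating word starting with `i`. -/
def alt (i j : B) : ℕ → List B
  | 0 => []
  | k + 1 => i :: alt j i k

lemma alt_length (i j : B) (k : ℕ) : (alt i j k).length = k := by
  induction k generalizing i j with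
  | zero => rfl
  | succ k ih => simp [alt, ih]

lemma alternatingWord_reverse (i j : B) (k : ℕ) :
    (alternatingWord i j k).reverse = alt j i k := by
  induction k generalizing i j with
  | zero => rfl
  | succ k ih => rw [alternatingWord_succ]; simp [alt, ih]

lemma alternatingWord_eq (i j : B) (k : ℕ) :
    alternatingWord i j k = if Even k then alt i j k else alt j i k := by
  induction k with
  | zero => rfl
  | succ k ih =>
    rw [alternatingWord_succ', ih]
    by_cases hk : Even k
    · have hk' : ¬ Even (k + 1) := by simpa [Nat.even_add_one] using hk
      simp [hk, hk', alt]
    · have hk' : Even (k + 1) := by simpa [Nat.even_add_one] using hk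
      simp [hk, hk', alt]

lemma alt_eq (i j : B) (k : ℕ) :
    alt i j k = if Even k then alternatingWord i j k else alternatingWord j i k := by
  rw [alternatingWord_eq, alternatingWord_eq]
  split_ifs <;> rfl

variable {M : CoxeterMatrix B} {W : Type*} [Group W] (cs : CoxeterSystem M W)

lemma length_mul_alt {v : W} {i j : B} (hij : i ≠ j) (hi : Asc cs v i) (hj : Asc cs v j)
    (k : ℕ) (hk : M.M i j ≠ 0 → k ≤ M.M i j) :
    cs.length (v * cs.wordProd (alt i j k)) = cs.length v + k := by
  rw [alt_eq]
  split_ifs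
  · exact length_mul_A cs hij hi hj k hk
  · exact length_mul_A cs hij.symm hj hi k (by rwa [Msymm])

lemma alt_reduced {i j : B} (hij : i ≠ j) (k : ℕ) (hk : M.M i j ≠ 0 → k ≤ M.M i j) :
    cs.IsReduced (alt i j k) := by
  have := length_mul_alt cs (v := 1) hij (by simp [Asc]) (by simp [Asc]) k hk
  simp only [one_mul, length_one, zero_add] at this
  rw [CoxeterSystem.IsReduced, this, alt_length]

lemma alt_braid (i j : B) : cs.wordProd (alt i j (M.M i j)) = cs.wordProd (alt j i (M.M i j)) := by
  rw [alt_eq, alt_eq]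
  have := A_braid cs i j
  unfold A at this
  split_ifs <;> simp [this]

lemma two_ldesc {w : W} {i j : B} (hij : i ≠ j) (hi : cs.length (cs.simple i * w) < cs.length w)
    (hj : cs.length (cs.simple j * w) < cs.length w) :
    M.M i j ≠ 0 ∧ ∃ y, w = cs.wordProd (alt i j (M.M i j)) * y ∧
      cs.length w = M.M i j + cs.length y := by
  have key : ∀ i, cs.length (cs.simple i * w) < cs.length w → ¬ Asc cs w⁻¹ i := by
    intro i hi h
    unfold Asc at h
    rw [← length_inv, cs.length_inv w] at h
    simp at h
    omega
  obtain ⟨hm, v, e, l⟩ := two_desc cs hij (key i hi) (key j hj)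
  refine ⟨hm, v⁻¹, ?_, ?_⟩
  · rw [alt_braid, ← alternatingWord_reverse, wordProd_reverse]
    change w = (A cs i j (M.M i j))⁻¹ * v⁻¹
    rw [← mul_inv_rev, ← e, inv_inv]
  · rw [length_inv] at l ⊢; omega

end words

section mon

variable {B : Type*} (M : CoxeterMatrix B)

/-- generator -/
abbrev sg (i : B) : ArtinTitsMonoid M := ArtinTitsMonoid.sigma M i

/-- image of a word -/
def mkw (l : List B) : ArtinTitsMonoid M := (l.map (sg M)).prod

lemma mkw_nil : mkw M [] = 1 := rfl
lemma mkw_cons (i : B) (l : List B) : mkw M (i :: l) = sg M i * mkw M l := by simp [mkw]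
lemma mkw_append (l l' : List B) : mkw M (l ++ l') = mkw M l * mkw M l' := by simp [mkw]

lemma mk_eq_mkw (l : List B) :
    (PresentedMonoid.mk (braidRels M) (FreeMonoid.ofList l) : ArtinTitsMonoid M) = mkw M l := by
  induction l with
  | nil => rfl
  | cons i l ih =>
    rw [mkw_cons, ← ih]
    rfl

lemma mkw_surj (x : ArtinTitsMonoid M) : ∃ l, mkw M l = x := by
  obtain ⟨a, ha⟩ := PresentedMonoid.surjective_mk (rels := braidRels M) x
  exact ⟨a.toList, by rw [← mk_eq_mkw, ← ha]; rfl⟩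

lemma mkw_braid (i j : B) : mkw M (alt i j (M.M i j)) = mkw M (alt j i (M.M i j)) := by
  by_cases h : M.M i j = 0
  · rw [h]; rfl
  have := PresentedMonoid.mk_eq_mk_of_rel (rels := braidRels M) ⟨i, j, h, rfl, rfl⟩
  have h2 : mkw M (alternatingWord i j (M.M i j)) = mkw M (alternatingWord j i (M.M i j)) := by
    rw [← mk_eq_mkw, ← mk_eq_mkw]; exact this
  rw [alt_eq, alt_eq]
  split_ifs <;> simp [h2]

/-- length hom -/
def lnHom : ArtinTitsMonoid M →* Multiplicative ℕ :=
  PresentedMonoid.lift (rels := braidRels M) (fun _ => Multiplicative.ofAdd 1) (by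
    rintro a b ⟨i, j, -, rfl, rfl⟩
    simp [FreeMonoid.lift_apply])

/-- length -/
def ln (x : ArtinTitsMonoid M) : ℕ := Multiplicative.toAdd (lnHom M x)

lemma ln_mul (x y : ArtinTitsMonoid M) : ln M (x * y) = ln M x + ln M y := by simp [ln]
lemma ln_one : ln M 1 = 0 := by simp [ln]
lemma ln_sg (i : B) : ln M (sg M i) = 1 := rfl
lemma ln_mkw (l : List B) : ln M (mkw M l) = l.length := by
  induction l with
  | nil => simp [mkw_nil, ln_one]
  | cons i l ih => rw [mkw_cons, ln_mul, ih, ln_sg, List.length_cons, add_comm]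

lemma ln_eq_zero {x : ArtinTitsMonoid M} (h : ln M x = 0) : x = 1 := by
  obtain ⟨l, rfl⟩ := mkw_surj M x
  rw [ln_mkw, List.length_eq_zero_iff] at h
  rw [h, mkw_nil]

/-- complement: `sg i * K i j = lcm` -/
def K (i j : B) : ArtinTitsMonoid M := mkw M (alt j i (M.M i j - 1))

lemma sg_K (i j : B) (h : M.M i j ≠ 0) : sg M i * K M i j = mkw M (alt i j (M.M i j)) := by
  obtain ⟨m, hm⟩ := Nat.exists_eq_succ_of_ne_zero h
  rw [K, hm, ← mkw_cons]; rfl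

lemma sg_K' (i j : B) (h : M.M i j ≠ 0) : sg M j * K M j i = mkw M (alt i j (M.M i j)) := by
  rw [sg_K M j i (by rwa [Msymm]), Msymm, mkw_braid]

/-- The reduction property -/
def Red (i : B) (X : ArtinTitsMonoid M) (j : B) (Y : ArtinTitsMonoid M) : Prop :=
  (i = j → X = Y) ∧ (i ≠ j → M.M i j ≠ 0 ∧ ∃ C, X = K M i j * C ∧ Y = K M j i * C)

/-- induction hypothesis -/
def IH (n : ℕ) : Prop := ∀ i X j Y, sg M i * X = sg M j * Y → ln M X < n → Red M i X j Y

variable {M}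

lemma Red.eq {i j : B} {X Y : ArtinTitsMonoid M} (h : Red M i X j Y) :
    sg M i * X = sg M j * Y := by
  by_cases hij : i = j
  · rw [h.1 hij, hij]
  · obtain ⟨hm, C, rfl, rfl⟩ := h.2 hij
    rw [← mul_assoc, ← mul_assoc, sg_K M i j hm, sg_K' M i j hm]

lemma Red.symm {i j : B} {X Y : ArtinTitsMonoid M} (h : Red M i X j Y) : Red M j Y i X := by
  refine ⟨fun e => (h.1 e.symm).symm, fun e => ?_⟩
  obtain ⟨hm, C, h1, h2⟩ := h.2 e.symm
  exact ⟨by rwa [Msymm], C, h2, h1⟩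

lemma IH.cancel {n : ℕ} (h : IH M n) (l : List B) {X Y : ArtinTitsMonoid M}
    (e : mkw M l * X = mkw M l * Y) (hl : ln M (mkw M l * X) ≤ n) : X = Y := by
  induction l with
  | nil => simpa [mkw_nil] using e
  | cons i l ih =>
    rw [mkw_cons, mul_assoc, mul_assoc] at e
    rw [mkw_cons, mul_assoc, ln_mul, ln_sg] at hl
    exact ih ((h _ _ _ _ e (by omega)).1 rfl) (by omega)

end mon

section lifting

variable {B : Type*} {M : CoxeterMatrix B} {W : Type*} [Group W] (cs : CoxeterSystem M W)

lemma red_tail {i : B} {l : List B} (h : cs.IsReduced (i :: l)) : cs.IsReduced l := by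
  simpa using h.drop 1

lemma red_append {l l' : List B}
    (h : cs.length (cs.wordProd l * cs.wordProd l') = l.length + l'.length) :
    cs.IsReduced (l ++ l') := by
  rw [CoxeterSystem.IsReduced, wordProd_append, h, List.length_append]

/-- Matsumoto -/
lemma matsumoto (l l' : List B) (h : cs.IsReduced l) (h' : cs.IsReduced l')
    (e : cs.wordProd l = cs.wordProd l') : mkw M l = mkw M l' := by
  induction hn : l.length using Nat.strong_induction_on generalizing l l' with
  | _ n ih =>
    have hlen : l.length = l'.length := by rw [← h.eq, ← h'.eq, e]
    match l, l' with
    | [], [] => rfl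
    | [], j :: v => simp at hlen
    | i :: u, [] => simp at hlen
    | i :: u, j :: v =>
      simp only [List.length_cons] at hn hlen
      rw [mkw_cons, mkw_cons]
      have hu := red_tail cs h
      have hv := red_tail cs h'
      by_cases hij : i = j
      · subst hij
        rw [ih u.length (by omega) u v hu hv (by simpa [wordProd_cons] using e) rfl]
      · have hw : cs.length (cs.wordProd (i :: u)) = u.length + 1 := by simpa using h.eq
        have di : cs.length (cs.simple i * cs.wordProd (i :: u)) <
            cs.length (cs.wordProd (i :: u)) := by
          rw [hw, wordProd_cons]; simp [hu.eq]
        have dj : cs.length (cs.simple j * cs.wordProd (i :: u)) <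
            cs.length (cs.wordProd (i :: u)) := by
          rw [hw, e, wordProd_cons]; simp [hv.eq]; omega
        obtain ⟨hm, y, ey, ly⟩ := two_ldesc cs hij di dj
        obtain ⟨c, hc, rfl⟩ := cs.exists_isReduced y
        rw [hc.eq] at ly
        have r1 : cs.IsReduced (alt i j (M.M i j) ++ c) := by
          apply red_append
          rw [← ey, alt_length]; exact ly
        have r2 : cs.IsReduced (alt j i (M.M i j) ++ c) := by
          apply red_append
          rw [← alt_braid, ← ey, alt_length]; exact ly
        have b := mkw_braid M i j
        have ey' := ey
        rw [alt_braid] at ey'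
        obtain ⟨m, hm'⟩ := Nat.exists_eq_succ_of_ne_zero hm
        rw [hm'] at r1 r2 ey ey' b
        simp only [Nat.succ_eq_add_one, alt, List.cons_append, wordProd_cons, mkw_cons, mul_assoc,
          mul_right_inj] at r1 r2 ey ey' b
        rw [← wordProd_cons, e, wordProd_cons, mul_right_inj] at ey'
        rw [← wordProd_append] at ey ey'
        rw [ih u.length (by omega) u _ hu (red_tail cs r1) ey rfl,
          ih v.length (by omega) v _ hv (red_tail cs r2) ey' rfl, mkw_append, mkw_append,
          ← mul_assoc, ← mul_assoc, b]

/-- lift -/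
noncomputable def lf (w : W) : ArtinTitsMonoid M := mkw M (cs.exists_isReduced w).choose

lemma lf_eq {l : List B} (h : cs.IsReduced l) : lf cs (cs.wordProd l) = mkw M l := by
  have := (cs.exists_isReduced (cs.wordProd l)).choose_spec
  exact (matsumoto cs _ _ h this.1 this.2).symm

lemma lf_mul {u v : W} (h : cs.length (u * v) = cs.length u + cs.length v) :
    lf cs (u * v) = lf cs u * lf cs v := by
  obtain ⟨a, ha, rfl⟩ := cs.exists_isReduced u
  obtain ⟨b, hb, rfl⟩ := cs.exists_isReduced v
  rw [ha.eq, hb.eq] at h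
  rw [lf_eq cs ha, lf_eq cs hb, ← wordProd_append, lf_eq cs (red_append cs h), mkw_append]

lemma lf_simple (i : B) : lf cs (cs.simple i) = sg M i := by
  have : cs.IsReduced [i] := by simp [CoxeterSystem.IsReduced]
  have h := lf_eq cs this
  simpa [mkw] using h

lemma lf_one : lf cs 1 = 1 := by
  have : cs.IsReduced [] := by simp [CoxeterSystem.IsReduced]
  simpa [mkw_nil] using lf_eq cs this

lemma ln_lf (w : W) : ln M (lf cs w) = cs.length w := by
  obtain ⟨a, ha, rfl⟩ := cs.exists_isReduced w
  rw [lf_eq cs ha, ln_mkw, ha.eq]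

/-- divisibility order -/
def Le (u g : W) : Prop := ∃ v, g = u * v ∧ cs.length g = cs.length u + cs.length v

lemma Le.refl (u : W) : Le cs u u := ⟨1, by simp, by simp⟩

variable {cs}

lemma Le.trans {u v w : W} (h : Le cs u v) (h' : Le cs v w) : Le cs u w := by
  obtain ⟨a, rfl, la⟩ := h
  obtain ⟨b, rfl, lb⟩ := h'
  refine ⟨a * b, by rw [mul_assoc], ?_⟩
  have h1 := cs.length_mul_le u (a * b)
  have h2 := cs.length_mul_le a b
  rw [← mul_assoc] at h1
  omega

lemma Le.dvd {u v : W} (h : Le cs u v) : LeftDvd (lf cs u) (lf cs v) := by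
  obtain ⟨a, rfl, la⟩ := h
  exact ⟨lf cs a, lf_mul cs la⟩

lemma Asc.le {v : W} {i : B} (h : Asc cs v i) : Le cs v (v * cs.simple i) :=
  ⟨_, rfl, by rw [h, cs.length_simple]⟩

lemma Le.step {v u : W} (h : Le cs v u) (hne : u ≠ v) :
    ∃ i, Asc cs v i ∧ Le cs (v * cs.simple i) u := by
  obtain ⟨a, rfl, la⟩ := h
  have ha : a ≠ 1 := by rintro rfl; simp at hne
  obtain ⟨i, hi⟩ := cs.exists_leftDescent_of_ne_one ha
  have h1 : cs.length (cs.simple i * a) + 1 = cs.length a := by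
    rcases cs.length_simple_mul a i with h | h
    · unfold IsLeftDescent at hi; omega
    · exact h
  have h2 := cs.length_mul_le (v * cs.simple i) (cs.simple i * a)
  have e : v * a = v * cs.simple i * (cs.simple i * a) := by simp [mul_assoc]
  rw [← e] at h2
  have h3 := cs.length_mul_simple v i
  have hasc : Asc cs v i := by unfold Asc; omega
  exact ⟨i, hasc, _, e, by rw [hasc]; omega⟩

/-- Newman-type lemma -/
lemma newman (E : W → Prop) (N : ℕ) (h1 : E 1) (hpre : ∀ u v, E v → Le cs u v → E u)
    (hN : ∀ v, E v → cs.length v ≤ N)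
    (conf : ∀ v i j, i ≠ j → Asc cs v i → Asc cs v j → E (v * cs.simple i) → E (v * cs.simple j) →
      M.M i j ≠ 0 ∧ E (v * cs.wordProd (alt i j (M.M i j)))) :
    ∃ g, E g ∧ ∀ v, E v → Le cs v g := by
  have key : ∀ n v, E v → N - cs.length v = n → ∃ g, E g ∧ ∀ u, E u → Le cs v u → Le cs u g := by
    intro n
    induction n using Nat.strong_induction_on with
    | _ n ih =>
      intro v hv hn
      by_cases hs : ∃ i, Asc cs v i ∧ E (v * cs.simple i)
      · obtain ⟨i, ai, Ei⟩ := hs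
        have hi := hN _ Ei
        have ai' : cs.length (v * cs.simple i) = cs.length v + 1 := ai
        obtain ⟨g, Eg, hg⟩ := ih (N - cs.length (v * cs.simple i)) (by omega) _ Ei rfl
        refine ⟨g, Eg, fun u Eu hu => ?_⟩
        by_cases huv : u = v
        · rw [huv]; exact ai.le.trans (hg _ Ei (Le.refl cs _))
        obtain ⟨j, aj, hj⟩ := hu.step huv
        by_cases hij : i = j
        · subst hij; exact hg _ Eu hj
        have Ej := hpre _ _ Eu hj
        have aj' : cs.length (v * cs.simple j) = cs.length v + 1 := aj
        obtain ⟨g', Eg', hg'⟩ := ih (N - cs.length (v * cs.simple j)) (by omega) _ Ej rfl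
        obtain ⟨hm, ED⟩ := conf v i j hij ai aj Ei Ej
        have lD := length_mul_alt cs hij ai aj (M.M i j) (fun _ => le_rfl)
        have lei : Le cs (v * cs.simple i) (v * cs.wordProd (alt i j (M.M i j))) := by
          obtain ⟨m, hm'⟩ := Nat.exists_eq_succ_of_ne_zero hm
          rw [hm'] at lD ⊢
          refine ⟨cs.wordProd (alt j i m), by simp [alt, wordProd_cons, mul_assoc], ?_⟩
          rw [lD, ai', (alt_reduced cs (Ne.symm hij) m (by rw [Msymm]; omega)).eq, alt_length]
          omega
        have lej : Le cs (v * cs.simple j) (v * cs.wordProd (alt i j (M.M i j))) := by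
          rw [alt_braid] at lD ⊢
          obtain ⟨m, hm'⟩ := Nat.exists_eq_succ_of_ne_zero hm
          rw [hm'] at lD ⊢
          refine ⟨cs.wordProd (alt i j m), by simp [alt, wordProd_cons, mul_assoc], ?_⟩
          rw [lD, aj', (alt_reduced cs hij m (by omega)).eq, alt_length]
          omega
        exact (hg' u Eu hj).trans (hg g' Eg' (lei.trans (hg' _ ED lej)))
      · refine ⟨v, hv, fun u Eu hu => ?_⟩
        by_cases huv : u = v
        · rw [huv]; exact Le.refl cs v
        obtain ⟨j, aj, hj⟩ := hu.step huv
        exact absurd ⟨j, aj, hpre _ _ Eu hj⟩ hs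
  obtain ⟨g, Eg, hg⟩ := key _ 1 h1 rfl
  exact ⟨g, Eg, fun v Ev => hg v Ev ⟨v, by simp, by simp⟩⟩

lemma LeftDvd.tr {a b c : ArtinTitsMonoid M} (h : LeftDvd a b) (h' : LeftDvd b c) :
    LeftDvd a c := by
  obtain ⟨x, rfl⟩ := h
  obtain ⟨y, rfl⟩ := h'
  exact ⟨x * y, mul_assoc _ _ _⟩

variable (cs)

lemma conf_dvd {n : ℕ} (ih : IH M n) {Z : ArtinTitsMonoid M} (hZ : ln M Z ≤ n)
    (v : W) (i j : B) (hij : i ≠ j) (ai : Asc cs v i) (aj : Asc cs v j)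
    (hi : LeftDvd (lf cs (v * cs.simple i)) Z) (hj : LeftDvd (lf cs (v * cs.simple j)) Z) :
    M.M i j ≠ 0 ∧ LeftDvd (lf cs (v * cs.wordProd (alt i j (M.M i j)))) Z := by
  obtain ⟨X, hX⟩ := hi
  obtain ⟨Y, hY⟩ := hj
  rw [lf_mul cs (by rw [ai, cs.length_simple]), lf_simple, mul_assoc] at hX
  rw [lf_mul cs (by rw [aj, cs.length_simple]), lf_simple, mul_assoc] at hY
  have hc : sg M i * X = sg M j * Y := ih.cancel _ (hX.symm.trans hY) (by
    change ln M (lf cs v * _) ≤ n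
    rw [← hX]; exact hZ)
  have hl : ln M X < n := by
    rw [hX, ln_mul, ln_mul, ln_sg] at hZ; omega
  obtain ⟨hm, C, e1, e2⟩ := (ih _ _ _ _ hc hl).2 hij
  refine ⟨hm, C, ?_⟩
  have hr := alt_reduced cs hij (M.M i j) (fun _ => le_rfl)
  rw [lf_mul, lf_eq cs hr, ← sg_K M i j hm, hX, e1]
  · simp only [mul_assoc]
  · rw [length_mul_alt cs hij ai aj _ (fun _ => le_rfl), hr.eq, alt_length]

lemma exists_max {n : ℕ} (ih : IH M n) {Z : ArtinTitsMonoid M} (hZ : ln M Z ≤ n) :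
    ∃ g : W, LeftDvd (lf cs g) Z ∧ ∀ v, LeftDvd (lf cs v) Z → Le cs v g := by
  apply newman (cs := cs) (fun v => LeftDvd (lf cs v) Z) n
  · exact ⟨Z, by rw [lf_one, one_mul]⟩
  · intro u v hv huv
    exact LeftDvd.tr huv.dvd hv
  · rintro v ⟨c, rfl⟩
    rw [ln_mul, ln_lf] at hZ; omega
  · exact conf_dvd cs ih hZ

/-- maximal left divisor with `r` ascending on the left. -/
lemma exists_max_asc (w : W) (r : B) :
    ∃ g : W, (Le cs g w ∧ cs.length (cs.simple r * g) = cs.length g + 1) ∧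
      ∀ v, (Le cs v w ∧ cs.length (cs.simple r * v) = cs.length v + 1) → Le cs v g := by
  apply newman (cs := cs) (fun v => Le cs v w ∧ cs.length (cs.simple r * v) = cs.length v + 1)
    (cs.length w)
  · exact ⟨⟨w, by simp, by simp⟩, by simp⟩
  · rintro u v ⟨h1, h2⟩ huv
    refine ⟨huv.trans h1, ?_⟩
    obtain ⟨a, rfl, la⟩ := huv
    have h3 := cs.length_mul_le (cs.simple r * u) a
    rw [mul_assoc] at h3
    have h4 := cs.length_simple_mul u r
    omega
  · rintro v ⟨⟨a, rfl, la⟩, -⟩; omega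
  · rintro v i j hij ai aj ⟨⟨a, ea, la⟩, ri⟩ ⟨⟨b, eb, lb⟩, rj⟩
    have ai' : cs.length (v * cs.simple i) = cs.length v + 1 := ai
    have aj' : cs.length (v * cs.simple j) = cs.length v + 1 := aj
    have hx1 : v⁻¹ * w = cs.simple i * a := by rw [ea]; group
    have hx2 : v⁻¹ * w = cs.simple j * b := by rw [eb]; group
    have hw := cs.length_mul_le v (v⁻¹ * w)
    rw [mul_inv_cancel_left] at hw
    have g1 : cs.simple i * (v⁻¹ * w) = a := by rw [hx1]; simp
    have g2 : cs.simple j * (v⁻¹ * w) = b := by rw [hx2]; simp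
    have hw2 := cs.length_mul_le (cs.simple i) a
    rw [← hx1, cs.length_simple] at hw2
    obtain ⟨hm, y, ey, ly⟩ := two_ldesc cs (w := v⁻¹ * w) hij (by rw [g1]; omega)
      (by rw [g2]; omega)
    have lD := length_mul_alt cs hij ai aj (M.M i j) (fun _ => le_rfl)
    refine ⟨hm, ⟨y, ?_, ?_⟩, ?_⟩
    · rw [mul_assoc, ← ey, mul_inv_cancel_left]
    · rw [lD]; omega
    · have rv : cs.length (cs.simple r * v) = cs.length v + 1 := by
        have h3 := cs.length_mul_le (cs.simple r * v) (cs.simple i)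
        rw [mul_assoc, cs.length_simple] at h3
        have h4 := cs.length_simple_mul v r
        omega
      rw [← mul_assoc, length_mul_alt cs hij _ _ (M.M i j) (fun _ => le_rfl), lD, rv]
      · omega
      · unfold Asc; rw [mul_assoc, ri, ai', rv]
      · unfold Asc; rw [mul_assoc, rj, aj', rv]

lemma red_trans_aux {i r : B} (hir : i ≠ r) (hm : M.M i r ≠ 0) {v x : W} 
    (hv : v = cs.wordProd (alt i r (M.M i r - 1)) * x) 
    (lv : cs.length v = cs.length (cs.wordProd (alt i r (M.M i r - 1))) + cs.length x)
    (rv : cs.length (cs.simple r * v) = cs.length v + 1) :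
    cs.simple r * v = cs.simple i * (cs.wordProd (alt r i (M.M i r - 1)) * x) ∧ 
    lf cs (cs.simple i * (cs.simple r * v)) = K M i r * lf cs x ∧
    cs.length (cs.simple i * (cs.simple r * v)) < cs.length (cs.simple r * v) := by
  have b := alt_braid cs i r
  have r1 := alt_reduced cs hir (M.M i r - 1) (by omega)
  have r2 := alt_reduced cs hir.symm (M.M i r - 1) (by rw [Msymm]; omega)
  obtain ⟨m, hm'⟩ := Nat.exists_eq_succ_of_ne_zero hm
  have e : cs.simple r * v = cs.simple i * (cs.wordProd (alt r i (M.M i r - 1)) * x) := by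
    rw [hm'] at b hv ⊢
    simp only [Nat.succ_eq_add_one, alt, wordProd_cons, Nat.add_sub_cancel] at b hv ⊢
    rw [hv, ← mul_assoc, ← b, mul_assoc]
  have e2 : cs.simple i * (cs.simple r * v) = cs.wordProd (alt r i (M.M i r - 1)) * x := by
    rw [e]; simp
  rw [r1.eq, alt_length] at lv
  have h1 := cs.length_mul_le (cs.wordProd (alt r i (M.M i r - 1))) x
  rw [r2.eq, alt_length] at h1
  have h2 := cs.length_simple_mul (cs.simple r * v) i
  have h3 : cs.length (cs.wordProd (alt r i (M.M i r - 1)) * x) = M.M i r - 1 + cs.length x := by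
    rw [e2] at h2; omega
  refine ⟨e, ?_, ?_⟩
  · rw [e2, lf_mul, lf_eq cs r2]
    · rfl
    · rw [h3, r2.eq, alt_length]
  · rw [e2, h3]; omega

end lifting

section main

variable {B : Type*} {M : CoxeterMatrix B}

lemma red_trans {n : ℕ} (ih : IH M n) {i r j : B} {X Z Y : ArtinTitsMonoid M}
    (hZ : ln M Z ≤ n) (h1 : Red M i X r Z) (h2 : Red M r Z j Y) : Red M i X j Y := by
  by_cases hir : i = r
  · obtain rfl := h1.1 hir
    rw [hir]; exact h2
  by_cases hrj : r = j
  · obtain rfl := h2.1 hrj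
    rw [← hrj]; exact h1
  obtain ⟨m1, C1, rfl, e1⟩ := h1.2 hir
  obtain ⟨m2, C2, e2, rfl⟩ := h2.2 hrj
  by_cases hij : i = j
  · subst hij
    have : C1 = C2 := ih.cancel _ (e1.symm.trans e2) (by
      change ln M (K M r i * C1) ≤ n
      rw [← e1]; exact hZ)
    rw [this]
    exact ⟨fun _ => rfl, fun h => absurd rfl h⟩
  refine ⟨fun h => absurd h hij, fun _ => ?_⟩
  let cs := M.toCoxeterSystem
  have hji : j ≠ r := fun h => hrj h.symm
  have m2' : M.M j r ≠ 0 := by rwa [Msymm]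
  have Ki : K M r i = mkw M (alt i r (M.M i r - 1)) := by rw [K, Msymm]
  have Kj : K M r j = mkw M (alt j r (M.M j r - 1)) := by rw [K, Msymm]
  have ri := alt_reduced cs hir (M.M i r - 1) (by omega)
  have rj := alt_reduced cs hji (M.M j r - 1) (by omega)
  have ei := lf_eq cs ri
  have ej := lf_eq cs rj
  rw [← Ki] at ei
  rw [← Kj] at ej
  obtain ⟨w, ⟨V0, hV0⟩, hw⟩ := exists_max cs ih hZ
  obtain ⟨v, ⟨hvw, rv⟩, hv⟩ := exists_max_asc cs w r
  have asc : ∀ i, i ≠ r → M.M i r ≠ 0 →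
      cs.length (cs.simple r * cs.wordProd (alt i r (M.M i r - 1))) =
      cs.length (cs.wordProd (alt i r (M.M i r - 1))) + 1 := by
    intro i hir hm
    rw [(alt_reduced cs hir (M.M i r - 1) (by omega)).eq, alt_length]
    have := (alt_reduced cs hir.symm (M.M i r) (by rw [Msymm]; omega)).eq
    obtain ⟨m, hm'⟩ := Nat.exists_eq_succ_of_ne_zero hm
    rw [hm'] at this ⊢
    simpa [alt, wordProd_cons, alt_length] using this
  obtain ⟨x1, ex1, lx1⟩ := hv _ ⟨hw (cs.wordProd (alt i r (M.M i r - 1)))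
    ⟨C1, by rw [ei]; exact e1⟩, asc i hir m1⟩
  obtain ⟨x2, ex2, lx2⟩ := hv _ ⟨hw (cs.wordProd (alt j r (M.M j r - 1)))
    ⟨C2, by rw [ej]; exact e2⟩, asc j hji m2'⟩
  obtain ⟨V1, hV1⟩ := hvw.dvd
  have eZ : Z = lf cs v * (V1 * V0) := by rw [hV0, hV1, mul_assoc]
  generalize V1 * V0 = V at eZ
  have eC1 : C1 = lf cs x1 * V := by
    refine ih.cancel (alt i r (M.M i r - 1)) ?_ (by rw [← Ki, ← e1]; exact hZ)
    rw [← Ki, ← e1, eZ, ← mul_assoc, ← ei, ← lf_mul cs (by rw [← ex1]; exact lx1), ← ex1]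
  have eC2 : C2 = lf cs x2 * V := by
    refine ih.cancel (alt j r (M.M j r - 1)) ?_ (by rw [← Kj, ← e2]; exact hZ)
    rw [← Kj, ← e2, eZ, ← mul_assoc, ← ej, ← lf_mul cs (by rw [← ex2]; exact lx2), ← ex2]
  obtain ⟨-, fi, di⟩ := red_trans_aux cs hir m1 ex1 lx1 rv
  obtain ⟨-, fj, dj⟩ := red_trans_aux cs hji m2' ex2 lx2 rv
  obtain ⟨hm, y, ey, ly⟩ := two_ldesc cs hij di dj
  refine ⟨hm, lf cs y * V, ?_⟩
  rw [eC1, eC2, ← mul_assoc, ← mul_assoc, ← mul_assoc, ← mul_assoc, ← fi, ← fj]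
  have key : ∀ i j, i ≠ j → M.M i j ≠ 0 →
      cs.simple r * v = cs.wordProd (alt i j (M.M i j)) * y →
      cs.length (cs.simple r * v) = M.M i j + cs.length y →
      cs.length (cs.simple i * (cs.simple r * v)) < cs.length (cs.simple r * v) →
      lf cs (cs.simple i * (cs.simple r * v)) = K M i j * lf cs y := by
    intro i j hij hm ey ly di
    have hr := alt_reduced cs (Ne.symm hij) (M.M i j - 1) (by rw [Msymm]; omega)
    have h2 := cs.length_simple_mul (cs.simple r * v) i
    have e : cs.simple i * (cs.simple r * v) = cs.wordProd (alt j i (M.M i j - 1)) * y := by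
      rw [ey]
      obtain ⟨m, hm'⟩ := Nat.exists_eq_succ_of_ne_zero hm
      rw [hm']
      simp [alt, wordProd_cons, mul_assoc]
    rw [e] at h2 ⊢
    rw [lf_mul, lf_eq cs hr]
    · rfl
    · rw [hr.eq, alt_length]
      rw [e] at di
      omega
  refine ⟨by rw [key i j hij hm ey ly di], ?_⟩
  rw [key j i (Ne.symm hij) (by rwa [Msymm]) (by rw [Msymm, ← alt_braid]; exact ey)
    (by rw [Msymm]; exact ly) dj]

lemma red_conGen {n : ℕ} (ih : IH M n) (a b : FreeMonoid B) (h : conGen (braidRels M) a b) :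
    mkw M a.toList = mkw M b.toList ∧ (a.toList.length ≤ n + 1 → ∀ i X j Y, a.toList = i :: X →
      b.toList = j :: Y → Red M i (mkw M X) j (mkw M Y)) := by
  have eqv : ∀ {a b : FreeMonoid B}, ConGen.Rel (braidRels M) a b →
      mkw M a.toList = mkw M b.toList := by
    intro a b h
    rw [← mk_eq_mkw, ← mk_eq_mkw]
    exact PresentedMonoid.mk_eq_mk_iff.2 h
  refine ⟨eqv h, ?_⟩
  change ConGen.Rel (braidRels M) a b at h
  induction h with
  | of a b h =>
    obtain ⟨i, j, hm, rfl, rfl⟩ := h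
    have key : ∀ i j i' X j' Y, M.M i j ≠ 0 → alt i j (M.M i j) = i' :: X →
        alt j i (M.M i j) = j' :: Y → Red M i' (mkw M X) j' (mkw M Y) := by
      intro i j i' X j' Y hm h1 h2
      have hK1 : K M i j = mkw M (alt j i (M.M i j - 1)) := rfl
      have hK2 : K M j i = mkw M (alt i j (M.M i j - 1)) := by rw [K, Msymm]
      have hmm := hm
      obtain ⟨m, hm'⟩ := Nat.exists_eq_succ_of_ne_zero hm
      rw [hm'] at h1 h2 hK1 hK2
      simp only [Nat.succ_eq_add_one, alt, List.cons.injEq, Nat.add_sub_cancel] at h1 h2 hK1 hK2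
      obtain ⟨rfl, rfl⟩ := h1
      obtain ⟨rfl, rfl⟩ := h2
      refine ⟨?_, fun _ => ⟨hmm, 1, by rw [mul_one, hK1], by rw [mul_one, hK2]⟩⟩
      rintro rfl; rfl
    intro _ i' X j' Y h1 h2
    simp only [FreeMonoid.toList_ofList] at h1 h2
    rw [alternatingWord_eq] at h1 h2
    split_ifs at h1 h2
    · exact key i j _ _ _ _ hm h1 h2
    · exact key j i _ _ _ _ (by rwa [Msymm]) (by rwa [Msymm]) (by rwa [Msymm])
  | refl a =>
    intro _ i X j Y h1 h2
    rw [h1] at h2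
    simp only [List.cons.injEq] at h2
    obtain ⟨rfl, rfl⟩ := h2
    exact ⟨fun _ => rfl, fun h => absurd rfl h⟩
  | symm h ih' =>
    intro hl i X j Y h1 h2
    have := congrArg (ln M) (eqv h)
    rw [ln_mkw, ln_mkw] at this
    exact (ih' (by omega) _ _ _ _ h2 h1).symm
  | @trans a c b hac hcb ih1 ih2 =>
    intro hl i X j Y h1 h2
    have := congrArg (ln M) (eqv hac)
    rw [ln_mkw, ln_mkw] at this
    match hc : c.toList with
    | [] => rw [hc, h1] at this; simp at this
    | r :: Z =>
      refine red_trans ih ?_ (ih1 hl _ _ _ _ h1 hc) (ih2 (by omega) _ _ _ _ hc h2)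
      rw [ln_mkw]
      rw [hc] at this
      simp only [List.length_cons] at this
      omega
  | @mul a b c d hab hcd ih1 ih2 =>
    intro hl i X j Y h1 h2
    have l1 := congrArg (ln M) (eqv hab)
    rw [ln_mkw, ln_mkw] at l1
    rw [FreeMonoid.toList_mul] at h1 h2 hl
    rw [List.length_append] at hl
    match ha : a.toList, hb : b.toList with
    | [], [] =>
      rw [ha] at h1
      rw [hb] at h2
      exact ih2 (by omega) _ _ _ _ h1 h2
    | [], _ :: _ => rw [ha, hb] at l1; simp at l1
    | _ :: _, [] => rw [ha, hb] at l1; simp at l1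
    | i' :: X', j' :: Y' =>
      have hr := ih1 (by omega) _ _ _ _ ha hb
      rw [ha, List.cons_append, List.cons.injEq] at h1
      rw [hb, List.cons_append, List.cons.injEq] at h2
      obtain ⟨rfl, rfl⟩ := h1
      obtain ⟨rfl, rfl⟩ := h2
      rw [mkw_append, mkw_append, eqv hcd]
      refine ⟨fun h => by rw [hr.1 h], fun h => ?_⟩
      obtain ⟨hm, C, e1, e2⟩ := hr.2 h
      exact ⟨hm, C * mkw M d.toList, by rw [e1, mul_assoc], by rw [e2, mul_assoc]⟩

lemma ih_all (n : ℕ) : IH M n := by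
  induction n with
  | zero => intro i X j Y _ h; omega
  | succ n ih =>
    intro i X j Y e hl
    obtain ⟨a, rfl⟩ := mkw_surj M X
    obtain ⟨b, rfl⟩ := mkw_surj M Y
    rw [ln_mkw] at hl
    rw [← mkw_cons, ← mkw_cons, ← mk_eq_mkw, ← mk_eq_mkw] at e
    have h := PresentedMonoid.mk_eq_mk_iff.1 e
    exact (red_conGen ih _ _ h).2 (by simp; omega) _ _ _ _ rfl rfl

lemma left_cancel {x y z : ArtinTitsMonoid M} (h : x * y = x * z) : y = z := by
  obtain ⟨l, rfl⟩ := mkw_surj M x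
  exact (ih_all _).cancel l h le_rfl

lemma exists_lcm (S : Set B) (x : ArtinTitsMonoid M) (hx : ∀ i ∈ S, LeftDvd (sg M i) x) :
    ∃ r, IsRightLcmOf (ArtinTitsMonoid.sigma M '' S) r := by
  let cs := M.toCoxeterSystem
  let Mult : ArtinTitsMonoid M → Prop := fun z => ∀ i ∈ S, LeftDvd (sg M i) z
  obtain ⟨g, h1, h2⟩ := newman (cs := cs) (fun v => ∀ z, Mult z → LeftDvd (lf cs v) z) (ln M x)
    (fun z _ => ⟨z, by rw [lf_one, one_mul]⟩)
    (fun u v hv huv z hz => LeftDvd.tr huv.dvd (hv z hz))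
    (fun v hv => by
      obtain ⟨c, hc⟩ := hv x hx
      rw [hc, ln_mul, ln_lf]; omega)
    (fun v i j hij ai aj hi hj =>
      ⟨(conf_dvd cs (ih_all _) le_rfl v i j hij ai aj (hi x hx) (hj x hx)).1, fun z hz =>
        (conf_dvd cs (ih_all _) le_rfl v i j hij ai aj (hi z hz) (hj z hz)).2⟩)
  refine ⟨lf cs g, ?_, ?_⟩
  · rintro _ ⟨i, hi, rfl⟩
    have := (h2 (cs.simple i) (fun z hz => by rw [lf_simple]; exact hz i hi)).dvd
    rwa [lf_simple] at this
  · intro z hz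
    exact h1 z (fun i hi => hz _ ⟨i, hi, rfl⟩)

lemma lcm_unique {X : Set (ArtinTitsMonoid M)} {r r' : ArtinTitsMonoid M}
    (h : IsRightLcmOf X r) (h' : IsRightLcmOf X r') : r = r' := by
  obtain ⟨c, hc⟩ := h.2 r' h'.1
  obtain ⟨d, hd⟩ := h'.2 r h.1
  have l1 := congrArg (ln M) hc
  have l2 := congrArg (ln M) hd
  rw [ln_mul] at l1 l2
  rw [ln_eq_zero M (show ln M c = 0 by omega), mul_one] at hc
  exact hc.symm

/-- diagram automorphism action -/
def act (g : Equiv.Perm B) (hg : ∀ i j : B, M.M (g i) (g j) = M.M i j) :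
    ArtinTitsMonoid M →* ArtinTitsMonoid M :=
  PresentedMonoid.lift (rels := braidRels M) (fun i => sg M (g i)) (by
    have key : ∀ i j k, FreeMonoid.lift (fun i => sg M (g i))
        (FreeMonoid.ofList (alternatingWord i j k)) = mkw M (alternatingWord (g i) (g j) k) := by
      intro i j k
      induction k with
      | zero => rfl
      | succ k ih =>
        rw [alternatingWord_succ', alternatingWord_succ', FreeMonoid.ofList_cons, map_mul, ih,
          mkw_cons, FreeMonoid.lift_eval_of, apply_ite g]
    rintro a b ⟨i, j, hm, rfl, rfl⟩

    rw [key, key, alternatingWord_eq, alternatingWord_eq, ← hg i j]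
    have := mkw_braid M (g i) (g j)
    split_ifs <;> simp [this])

lemma act_sg (g : Equiv.Perm B) (hg : ∀ i j : B, M.M (g i) (g j) = M.M i j) (i : B) :
    act g hg (sg M i) = sg M (g i) := rfl

lemma act_dvd (g : Equiv.Perm B) (hg : ∀ i j : B, M.M (g i) (g j) = M.M i j)
    {x y : ArtinTitsMonoid M} (h : LeftDvd x y) : LeftDvd (act g hg x) (act g hg y) := by
  obtain ⟨c, rfl⟩ := h
  exact ⟨act g hg c, map_mul _ _ _⟩

lemma act_inv (g : Equiv.Perm B) (hg : ∀ i j : B, M.M (g i) (g j) = M.M i j)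
    (hg' : ∀ i j : B, M.M (g⁻¹ i) (g⁻¹ j) = M.M i j) (x : ArtinTitsMonoid M) :
    act g hg (act g⁻¹ hg' x) = x := by
  obtain ⟨l, rfl⟩ := mkw_surj M x
  induction l with
  | nil => simp [mkw_nil]
  | cons i l ih => rw [mkw_cons, map_mul, map_mul, ih, act_sg, act_sg]; simp

theorem main (G : Subgroup (Equiv.Perm B))
    (hG : ∀ g ∈ G, ∀ i j : B, M.M (g i) (g j) = M.M i j)
    (n : ℕ) (x : ArtinTitsMonoid M) (hn : ln M x = n)
    (hx : ∀ g (hg : g ∈ G), act g (hG g hg) x = x) :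
    x ∈ Submonoid.closure {r : ArtinTitsMonoid M | ∃ i0 : B,
      IsRightLcmOf (ArtinTitsMonoid.sigma M '' MulAction.orbit G i0) r} := by
  induction n using Nat.strong_induction_on generalizing x with
  | _ n ih =>
    obtain ⟨l, hl⟩ := mkw_surj M x
    match l with
    | [] => rw [← hl, mkw_nil]; exact Submonoid.one_mem _
    | i :: l =>
      have hi : LeftDvd (sg M i) x := ⟨mkw M l, by rw [← hl, mkw_cons]⟩
      have hS : ∀ j ∈ MulAction.orbit G i, LeftDvd (sg M j) x := by
        rintro _ ⟨⟨g, hg⟩, rfl⟩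
        have := act_dvd g (hG g hg) hi
        rw [hx g hg, act_sg] at this
        exact this
      obtain ⟨r, hr⟩ := exists_lcm (MulAction.orbit G i) x hS
      obtain ⟨y, hy⟩ := hr.2 x (by rintro _ ⟨j, hj, rfl⟩; exact hS j hj)
      have orb : ∀ g ∈ G, ∀ j ∈ MulAction.orbit G i, g j ∈ MulAction.orbit G i := by
        intro g hg j hj
        exact MulAction.mem_orbit_of_mem_orbit (⟨g, hg⟩ : G) hj
      have up : ∀ g (hg : g ∈ G) z, (∀ s ∈ ArtinTitsMonoid.sigma M '' MulAction.orbit G i,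
          LeftDvd s z) → ∀ s ∈ ArtinTitsMonoid.sigma M '' MulAction.orbit G i,
          LeftDvd s (act g (hG g hg) z) := by
        rintro g hg z hz _ ⟨j, hj, rfl⟩
        have h := act_dvd g (hG g hg) (hz _ ⟨g⁻¹ j, orb _ (inv_mem hg) _ hj, rfl⟩)
        rw [act_sg] at h
        simpa using h
      have fr : ∀ g (hg : g ∈ G), act g (hG g hg) r = r := by
        intro g hg
        refine lcm_unique ⟨up g hg r hr.1, fun z hz => ?_⟩ hr
        have h := hr.2 _ (up g⁻¹ (inv_mem hg) z hz)
        have h' := act_dvd g (hG g hg) h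
        rwa [act_inv] at h'
      have fy : ∀ g (hg : g ∈ G), act g (hG g hg) y = y := by
        intro g hg
        have h := hx g hg
        rw [hy, map_mul, fr g hg] at h
        exact left_cancel h
      have lr : 0 < ln M r := by
        obtain ⟨c, hc⟩ := hr.1 (sg M i) ⟨i, MulAction.mem_orbit_self i, rfl⟩
        rw [hc, ln_mul, ln_sg]; omega
      rw [hy]
      refine Submonoid.mul_mem _ (Submonoid.subset_closure ⟨i, hr⟩) (ih (ln M y) ?_ y rfl fy)
      rw [← hn, hy, ln_mul]; omega

end main

end ATM


/-- Every element of the Artin–Tits monoid fixed by a group `G` of automorphisms of the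
Coxeter matrix lies in the submonoid generated by the elements `r_α`, where `α` runs over
the spherical orbits of the index set under `G` and `r_α` is the right lcm of
`{s_i : i ∈ α}` (which exists exactly when `α` is spherical). -/
theorem fixed_points_in_submonoid_of_orbit_lcms {B : Type*} (M : CoxeterMatrix B)
    (G : Subgroup (Equiv.Perm B))
    (hG : ∀ g ∈ G, ∀ i j : B, M.M (g i) (g j) = M.M i j)
    (x : ArtinTitsMonoid M)
    (hx : ∀ g ∈ G, ∀ φ : ArtinTitsMonoid M →* ArtinTitsMonoid M,
      (∀ i : B, φ (ArtinTitsMonoid.sigma M i) = ArtinTitsMonoid.sigma M (g i)) → φ x = x) :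
    x ∈ Submonoid.closure {r : ArtinTitsMonoid M | ∃ i0 : B,
      IsRightLcmOf (ArtinTitsMonoid.sigma M '' MulAction.orbit G i0) r} := by
  exact ATM.main G hG _ x rfl (fun g hg => hx g hg _ (ATM.act_sg g (hG g hg)))
end
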